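/- arXiv:2311.13154 — 3 statements merged into one kernel-verified Lean document; each statement's English description precedes it below -/
import Mathlib

section
/- There are sufficiently large universal constants C, C₀ and universal constants A, c > 0 such that, with α_d = C₀·d²·2^(2^(d+1)), the following holds. Let p, q be probability distributions on ℝ^d each of whose one-dimensional coordinate marginals has a continuous cumulative distribution function, and suppose ‖p − q‖_{A_k} ≥ ε. Let S be a set of N i.i.d. samples from (1/2)(p + q), where N ∼ Poisson(m) and k > m ≥ C·√k/(ε/4)^(2α_d), and let G_S be the sample-point grid of S. Then with probability at least 9/10 there exist k′ ≤ 3k pairwise disjoint grid-aligned rectangles R̃_1, …, R̃_{k′} with respect to G_S satisfying: (i) p(R̃_i) + q(R̃_i) ≤ A/k for all i ∈ [k′], and (ii) Σ_{i=1}^{k′} (p(R̃_i) − q(R̃_i))² ≥ c·(ε/4)^(2α_d)·m²/k³. -/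
open MeasureTheory
open scoped NNReal ENNReal

/-- An axis-aligned rectangle in `ℝ^d` is a product of `d` intervals. -/
def IsAxisAlignedRectangle {d : ℕ} (R : Set (Fin d → ℝ)) : Prop :=
  ∃ I : Fin d → Set ℝ, (∀ i, (I i).OrdConnected) ∧ R = Set.univ.pi I

/-- The `A_k` distance between two measures on `ℝ^d`. -/
noncomputable def AkDist {d : ℕ} (k : ℕ) (p q : Measure (Fin d → ℝ)) : ℝ :=
  ⨆ R : {R : Fin k → Set (Fin d → ℝ) //
      (∀ i, IsAxisAlignedRectangle (R i)) ∧
      Pairwise fun i j => Disjoint (R i) (R j)},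
    ∑ i, |(p (R.1 i)).toReal - (q (R.1 i)).toReal|

/-- A rectangle is grid-aligned with respect to the sample-point grid of the tuple `s`
if all its vertices are grid points, i.e., it is spanned by two grid points. -/
def GridAligned {d n : ℕ} (s : Fin n → Fin d → ℝ) (R : Set (Fin d → ℝ)) : Prop :=
  ∃ a b : Fin d → Fin n,
    R = {z | ∀ l, min (s (a l) l) (s (b l) l) ≤ z l ∧
                  z l ≤ max (s (a l) l) (s (b l) l)}

/-- The law of a sample of `Poisson(m)` many i.i.d. draws from `ν`, as a measure on the
space `Σ n, (Fin n → X)` of finite sample tuples. -/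
noncomputable def iidPoissonSamples {X : Type*} [MeasurableSpace X] (m : ℝ≥0)
    (ν : Measure X) : Measure (Σ n : ℕ, Fin n → X) :=
  Measure.sum fun n =>
    (ProbabilityTheory.poissonPMF m n) •
      (Measure.pi fun _ : Fin n => ν).map (Sigma.mk n)

/-- The closed axis-aligned box spanned by two opposite vertices. -/
def spannedBox {d : ℕ} (x y : Fin d → ℝ) : Set (Fin d → ℝ) :=
  {z | ∀ l, min (x l) (y l) ≤ z l ∧ z l ≤ max (x l) (y l)}

/-- Among the points of a sequence, at most `2 ^ 2 ^ d` fail to lie in the box spanned by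
an earlier and a later point. -/
theorem card_not_mem_spannedBox_le {d N : ℕ} (x : Fin N → Fin d → ℝ) :
    {b : Fin N | ¬ ∃ a c, a < b ∧ b < c ∧ x b ∈ spannedBox (x a) (x c)}.ncard ≤ 2 ^ 2 ^ d := by
  classical
  set M := {b : Fin N | ¬ ∃ a c, a < b ∧ b < c ∧ x b ∈ spannedBox (x a) (x c)} with hM
  let sgn : Fin N → Fin N → Finset (Fin d) := fun a b => {l | x a l ≤ x b l}
  let inc : Fin N → Finset (Finset (Fin d)) := fun b => {s | ∃ a < b, sgn a b = s}
  have key : ∀ a b, a ∈ M → a < b → inc a ≠ inc b := by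
    intro a b ha hab heq
    have h1 : sgn a b ∈ inc b := by simp only [inc, Finset.mem_filter_univ]; exact ⟨a, hab, rfl⟩
    rw [← heq] at h1
    simp only [inc, Finset.mem_filter_univ] at h1
    obtain ⟨a', ha', hs⟩ := h1
    refine ha ⟨a', b, ha', hab, fun l => ?_⟩
    have hl : x a' l ≤ x a l ↔ x a l ≤ x b l := by
      have := congrArg (fun s => l ∈ s) hs
      simpa [sgn] using this
    by_cases h : x a' l ≤ x a l
    · exact ⟨(min_le_left _ _).trans h, (hl.1 h).trans (le_max_right _ _)⟩
    · have h2 := mt hl.2 h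
      exact ⟨(min_le_right _ _).trans (not_le.1 h2).le, (not_le.1 h).le.trans (le_max_left _ _)⟩
  have hinj : Set.InjOn inc M := by
    intro a ha b hb hab
    rcases lt_trichotomy a b with h | h | h
    · exact absurd hab (key a b ha h)
    · exact h
    · exact absurd hab.symm (key b a hb h)
  calc M.ncard ≤ (Set.univ : Set (Finset (Finset (Fin d)))).ncard :=
        Set.ncard_le_ncard_of_injOn inc (fun _ _ => Set.mem_univ _) hinj
    _ = 2 ^ 2 ^ d := by simp [Set.ncard_univ]

theorem iIndepFun_eval_pi {ι E : Type*} [Fintype ι] [MeasurableSpace E] (μ : Measure E)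
    [IsProbabilityMeasure μ] :
    ProbabilityTheory.iIndepFun (fun i (x : ι → E) => x i) (Measure.pi fun _ => μ) :=
  ProbabilityTheory.iIndepFun_pi (X := fun _ => id) fun _ => aemeasurable_id

theorem map_eval_pi_const {ι E : Type*} [Fintype ι] [MeasurableSpace E] (μ : Measure E)
    [IsProbabilityMeasure μ] (i : ι) :
    (Measure.pi fun _ : ι => μ).map (fun x => x i) = μ :=
  (measurePreserving_eval (fun _ : ι => μ) i).map_eq

theorem map_pair_pi {ι E : Type*} [Fintype ι] [MeasurableSpace E] (μ : Measure E)
    [IsProbabilityMeasure μ] {a b : ι} (hab : a ≠ b) :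
    (Measure.pi fun _ : ι => μ).map (fun x => (x a, x b)) = μ.prod μ := by
  have h := (iIndepFun_eval_pi (ι := ι) μ).indepFun hab
  rw [ProbabilityTheory.indepFun_iff_map_prod_eq_prod_map_map
    (measurable_pi_apply a).aemeasurable (measurable_pi_apply b).aemeasurable] at h
  rw [h, map_eval_pi_const, map_eval_pi_const]

theorem map_triple_pi {ι E : Type*} [Fintype ι] [MeasurableSpace E] (μ : Measure E)
    [IsProbabilityMeasure μ] {a b c : ι} (hab : a ≠ b) (hac : a ≠ c) (hbc : b ≠ c) :
    (Measure.pi fun _ : ι => μ).map (fun x => ((x a, x b), x c)) = (μ.prod μ).prod μ := by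
  have h := (iIndepFun_eval_pi (ι := ι) μ).indepFun_prodMk (fun i => by fun_prop) a b c hac hbc
  rw [ProbabilityTheory.indepFun_iff_map_prod_eq_prod_map_map
    (by fun_prop) (measurable_pi_apply c).aemeasurable] at h
  rw [h, map_eval_pi_const, map_pair_pi μ hab]

theorem map_quadruple_pi {ι E : Type*} [Fintype ι] [MeasurableSpace E] (μ : Measure E)
    [IsProbabilityMeasure μ] {a b c e : ι} (hab : a ≠ b) (hce : c ≠ e) (hac : a ≠ c)
    (hae : a ≠ e) (hbc : b ≠ c) (hbe : b ≠ e) :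
    (Measure.pi fun _ : ι => μ).map (fun x => ((x a, x b), (x c, x e))) =
      (μ.prod μ).prod (μ.prod μ) := by
  have h := (iIndepFun_eval_pi (ι := ι) μ).indepFun_prodMk_prodMk
    (fun i => by fun_prop) a b c e hac hae hbc hbe
  rw [ProbabilityTheory.indepFun_iff_map_prod_eq_prod_map_map
    (by fun_prop) (by fun_prop)] at h
  rw [h, map_pair_pi μ hab, map_pair_pi μ hce]

/-- The expected number of events that occur is the sum of their probabilities. -/
theorem integral_ncard_eq_sum {Ω ι : Type*} [MeasurableSpace Ω] [Fintype ι] (P : Measure Ω)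
    [IsFiniteMeasure P] {A : ι → Set Ω} (hA : ∀ i, MeasurableSet (A i)) :
    Integrable (fun ω => ({i | ω ∈ A i}.ncard : ℝ)) P ∧
      ∫ ω, ({i | ω ∈ A i}.ncard : ℝ) ∂P = ∑ i, P.real (A i) := by
  classical
  have h : (fun ω => ({i | ω ∈ A i}.ncard : ℝ)) =
      fun ω => ∑ i, (A i).indicator (fun _ => (1 : ℝ)) ω := by
    funext ω
    simp [Set.indicator_apply, Set.ncard_eq_toFinset_card']
  have hi : ∀ i, Integrable ((A i).indicator fun _ => (1 : ℝ)) P := fun i =>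
    (integrable_const 1).indicator (hA i)
  rw [h]
  refine ⟨integrable_finsetSum _ fun i _ => hi i, ?_⟩
  rw [integral_finsetSum _ fun i _ => hi i]
  exact Finset.sum_congr rfl fun i _ => integral_indicator_one (hA i)

theorem measurableSet_mem_spannedBox (d : ℕ) :
    MeasurableSet {w : ((Fin d → ℝ) × (Fin d → ℝ)) × (Fin d → ℝ) |
      w.2 ∈ spannedBox w.1.1 w.1.2} := by
  have h : {w : ((Fin d → ℝ) × (Fin d → ℝ)) × (Fin d → ℝ) | w.2 ∈ spannedBox w.1.1 w.1.2} =
      ⋂ l, ({w | min (w.1.1 l) (w.1.2 l) ≤ w.2 l} ∩ {w | w.2 l ≤ max (w.1.1 l) (w.1.2 l)}) := by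
    ext w
    simp only [spannedBox, Set.mem_iInter, Set.mem_inter_iff, Set.mem_ofPred_eq]
  rw [h]
  refine MeasurableSet.iInter fun l => MeasurableSet.inter ?_ ?_
  · exact measurableSet_le (by fun_prop) (by fun_prop)
  · exact measurableSet_le (by fun_prop) (by fun_prop)

theorem measurableSet_spannedBox {d : ℕ} (x y : Fin d → ℝ) : MeasurableSet (spannedBox x y) :=
  measurable_prodMk_left (measurableSet_mem_spannedBox d) (x := (x, y))

/-- A random point lies in the box spanned by two other independent copies of it with
probability bounded below in terms of the dimension only. -/
theorem le_prob_mem_spannedBox {d : ℕ} (μ : Measure (Fin d → ℝ)) [IsProbabilityMeasure μ] :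
    1 / (8 * (2 : ℝ) ^ 2 ^ (d + 1)) ≤ ((μ.prod μ).prod μ).real
      {w | w.2 ∈ spannedBox w.1.1 w.1.2} := by
  classical
  set K : ℕ := 2 ^ 2 ^ d with hK
  have hKpos : 0 < K := by positivity
  set t := ((μ.prod μ).prod μ).real {w | w.2 ∈ spannedBox w.1.1 w.1.2} with ht
  let P : Measure (Fin (2 * K) → Fin d → ℝ) := Measure.pi fun _ => μ
  let A : Fin (2 * K) × Fin (2 * K) × Fin (2 * K) → Set (Fin (2 * K) → Fin d → ℝ) :=
    fun e => {x | e.1 < e.2.1 ∧ e.2.1 < e.2.2 ∧ x e.2.1 ∈ spannedBox (x e.1) (x e.2.2)}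
  have hmeas : ∀ a b c : Fin (2 * K),
      Measurable fun x : Fin (2 * K) → Fin d → ℝ => ((x a, x c), x b) := fun a b c => by fun_prop
  have hA : ∀ e, MeasurableSet (A e) := by
    intro e
    by_cases h1 : e.1 < e.2.1
    · by_cases h2 : e.2.1 < e.2.2
      · have : A e = (fun x => ((x e.1, x e.2.2), x e.2.1)) ⁻¹'
            {w | w.2 ∈ spannedBox w.1.1 w.1.2} := by
          ext x; simp [A, h1, h2]
        rw [this]
        exact hmeas _ _ _ (measurableSet_mem_spannedBox d)
      · simp [A, h2]
    · simp [A, h1]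
  have hAt : ∀ e, P.real (A e) ≤ t := by
    intro e
    by_cases h1 : e.1 < e.2.1
    · by_cases h2 : e.2.1 < e.2.2
      · have : A e = (fun x => ((x e.1, x e.2.2), x e.2.1)) ⁻¹'
            {w | w.2 ∈ spannedBox w.1.1 w.1.2} := by
          ext x; simp [A, h1, h2]
        rw [this, ← map_measureReal_apply (hmeas _ _ _) (measurableSet_mem_spannedBox d),
          map_triple_pi μ (h1.trans h2).ne h1.ne h2.ne']
      · simp [A, h2, ht]
    · simp [A, h1, ht]
  have hcount : ∀ x : Fin (2 * K) → Fin d → ℝ, (K : ℝ) ≤ ({e | x ∈ A e}.ncard : ℝ) := by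
    intro x
    have h1 := card_not_mem_spannedBox_le x
    set M := {b : Fin (2 * K) | ¬ ∃ a c, a < b ∧ b < c ∧ x b ∈ spannedBox (x a) (x c)}
    have h2 : Mᶜ.ncard ≤ {e | x ∈ A e}.ncard := by
      have hsub : Mᶜ ⊆ (fun e : Fin (2 * K) × Fin (2 * K) × Fin (2 * K) => e.2.1) ''
          {e | x ∈ A e} := by
        intro b hb
        simp only [M, Set.mem_compl_iff, Set.mem_ofPred_eq, not_not] at hb
        obtain ⟨a, c, h⟩ := hb
        exact ⟨(a, b, c), h, rfl⟩
      exact (Set.ncard_le_ncard hsub).trans (Set.ncard_image_le)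
    have h3 := Set.ncard_add_ncard_compl M
    simp only [Nat.card_eq_fintype_card, Fintype.card_fin] at h3
    exact_mod_cast (by omega : K ≤ {e | x ∈ A e}.ncard)
  have hsum : (K : ℝ) ≤ (2 * K) ^ 3 * t := by
    obtain ⟨hN_int, heq⟩ := integral_ncard_eq_sum P hA
    calc (K : ℝ) = ∫ _, (K : ℝ) ∂P := by simp
      _ ≤ ∫ x, ({e | x ∈ A e}.ncard : ℝ) ∂P :=
        integral_mono (integrable_const _) hN_int hcount
      _ = ∑ e, P.real (A e) := heq
      _ ≤ ∑ _e : Fin (2 * K) × Fin (2 * K) × Fin (2 * K), t :=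
        Finset.sum_le_sum fun e _ => hAt e
      _ = (2 * K) ^ 3 * t := by
        rw [Finset.sum_const, nsmul_eq_mul]; simp only [Finset.card_univ, Fintype.card_prod,
          Fintype.card_fin]; push_cast; ring
  have hK2 : (2 : ℝ) ^ 2 ^ (d + 1) = (K : ℝ) ^ 2 := by
    rw [hK]; push_cast; rw [← pow_mul, pow_succ 2 d]
  have hKr : (0 : ℝ) < K := by exact_mod_cast hKpos
  rw [hK2, div_le_iff₀ (by positivity)]
  have : (K : ℝ) * 1 ≤ K * (t * (8 * K ^ 2)) := by linarith
  exact le_of_mul_le_mul_left this hKr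

theorem measurable_measureReal_spannedBox {d : ℕ} (μ : Measure (Fin d → ℝ)) [SFinite μ] :
    Measurable fun w : (Fin d → ℝ) × (Fin d → ℝ) => μ.real (spannedBox w.1 w.2) :=
  (measurable_measure_prodMk_left (ν := μ) (measurableSet_mem_spannedBox d)).ennreal_toReal

/-- The box spanned by two independent random points has non-negligible mass with
non-negligible probability. -/
theorem le_prob_le_measure_spannedBox {d : ℕ} (μ : Measure (Fin d → ℝ)) [IsProbabilityMeasure μ]
    {δ : ℝ} (hδ0 : 0 ≤ δ) (hδ : δ ≤ 1 / (16 * (2 : ℝ) ^ 2 ^ (d + 1))) :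
    δ ≤ (μ.prod μ).real {w | δ ≤ μ.real (spannedBox w.1 w.2)} := by
  have h1 := le_prob_mem_spannedBox μ
  have hm := measurable_measureReal_spannedBox μ
  have hG : MeasurableSet {w : (Fin d → ℝ) × (Fin d → ℝ) | δ ≤ μ.real (spannedBox w.1 w.2)} :=
    measurableSet_le measurable_const hm
  set G := {w : (Fin d → ℝ) × (Fin d → ℝ) | δ ≤ μ.real (spannedBox w.1 w.2)}
  have h2 : ((μ.prod μ).prod μ).real {w | w.2 ∈ spannedBox w.1.1 w.1.2} =
      ∫ w, μ.real (spannedBox w.1 w.2) ∂(μ.prod μ) := by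
    rw [measureReal_def, Measure.prod_apply (measurableSet_mem_spannedBox d),
      integral_eq_lintegral_of_nonneg_ae (Filter.Eventually.of_forall fun _ => measureReal_nonneg)
        hm.aestronglyMeasurable]
    congr 1
    refine lintegral_congr fun w => ?_
    rw [ofReal_measureReal]
    rfl
  have hi1 : Integrable (G.indicator fun _ => (1 : ℝ)) (μ.prod μ) :=
    (integrable_const 1).indicator hG
  have h3 : ∫ w, μ.real (spannedBox w.1 w.2) ∂(μ.prod μ) ≤
      ∫ w, (δ + G.indicator (fun _ => (1 : ℝ)) w) ∂(μ.prod μ) := by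
    refine integral_mono_of_nonneg (Filter.Eventually.of_forall fun _ => measureReal_nonneg)
      ((integrable_const _).add hi1) (Filter.Eventually.of_forall fun w => ?_)
    by_cases hw : w ∈ G
    · simp only [Set.indicator_of_mem hw]
      linarith [measureReal_le_one (μ := μ) (s := spannedBox w.1 w.2)]
    · simp only [Set.indicator_of_notMem hw]
      have : μ.real (spannedBox w.1 w.2) < δ := not_le.1 hw
      linarith
  rw [integral_add (integrable_const _) hi1] at h3
  have h4 : ∫ w, G.indicator (fun _ => (1 : ℝ)) w ∂(μ.prod μ) = (μ.prod μ).real G :=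
    integral_indicator_one hG
  rw [h4] at h3
  simp only [integral_const, probReal_univ, one_smul] at h3
  have h5 : 1 / (8 * (2 : ℝ) ^ 2 ^ (d + 1)) = 2 * (1 / (16 * (2 : ℝ) ^ 2 ^ (d + 1))) := by
    field_simp; norm_num
  linarith

theorem IsAxisAlignedRectangle.measurableSet {d : ℕ} {T : Set (Fin d → ℝ)}
    (hT : IsAxisAlignedRectangle T) : MeasurableSet T := by
  obtain ⟨I, hI, rfl⟩ := hT
  exact MeasurableSet.univ_pi fun i => (hI i).measurableSet

theorem IsAxisAlignedRectangle.inter {d : ℕ} {S T : Set (Fin d → ℝ)}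
    (hS : IsAxisAlignedRectangle S) (hT : IsAxisAlignedRectangle T) :
    IsAxisAlignedRectangle (S ∩ T) := by
  obtain ⟨I, hI, rfl⟩ := hS
  obtain ⟨J, hJ, rfl⟩ := hT
  exact ⟨fun i => I i ∩ J i, fun i => (hI i).inter (hJ i), Set.pi_inter_distrib.symm⟩

theorem isAxisAlignedRectangle_setOf_mem {d : ℕ} (l : Fin d) {I : Set ℝ} (hI : I.OrdConnected) :
    IsAxisAlignedRectangle {z : Fin d → ℝ | z l ∈ I} := by
  classical
  refine ⟨fun i => if i = l then I else Set.univ, fun i => ?_, ?_⟩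
  · dsimp only
    split_ifs
    · exact hI
    · exact Set.ordConnected_univ
  · ext z
    simp only [Set.mem_ofPred_eq, Set.mem_univ_pi]
    refine ⟨fun h i => ?_, fun h => by simpa using h l⟩
    split_ifs with hi
    · exact hi ▸ h
    · trivial

theorem IsAxisAlignedRectangle.spannedBox_subset {d : ℕ} {T : Set (Fin d → ℝ)}
    (hT : IsAxisAlignedRectangle T) {x y : Fin d → ℝ} (hx : x ∈ T) (hy : y ∈ T) :
    spannedBox x y ⊆ T := by
  obtain ⟨I, hI, rfl⟩ := hT
  intro z hz i _
  exact (hI i).uIcc_subset (hx i trivial) (hy i trivial) (hz i)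

/-- Two independent random points both lie in a given rectangle and span a box carrying a
fixed proportion of the mass of that rectangle with non-negligible probability. -/
theorem le_measure_good_pairs {d : ℕ} (μ : Measure (Fin d → ℝ)) [IsFiniteMeasure μ]
    {T : Set (Fin d → ℝ)} (hT : MeasurableSet T) {δ : ℝ} (hδ0 : 0 ≤ δ)
    (hδ : δ ≤ 1 / (16 * (2 : ℝ) ^ 2 ^ (d + 1))) :
    δ * μ.real T ^ 2 ≤ (μ.prod μ).real
      {w | w.1 ∈ T ∧ w.2 ∈ T ∧ δ * μ.real T ≤ μ.real (spannedBox w.1 w.2)} := by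
  rcases (measureReal_nonneg (μ := μ) (s := T)).eq_or_lt with h0 | hpos
  · rw [← h0]; simp
  have hTne : μ T ≠ 0 := fun h => by simp [measureReal_def, h] at hpos
  let ρ := ProbabilityTheory.cond μ T
  have hρ : IsProbabilityMeasure ρ := ProbabilityTheory.cond_isProbabilityMeasure hTne
  have hρa : ∀ B, MeasurableSet B → ρ.real B = (μ.real T)⁻¹ * μ.real (T ∩ B) := fun B _ => by
    simp only [ρ, measureReal_def, ProbabilityTheory.cond_apply hT, ENNReal.toReal_mul,
      ENNReal.toReal_inv]
  have h1 := le_prob_le_measure_spannedBox ρ hδ0 hδ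
  have hG : MeasurableSet {w : (Fin d → ℝ) × (Fin d → ℝ) | δ ≤ ρ.real (spannedBox w.1 w.2)} :=
    measurableSet_le measurable_const (measurable_measureReal_spannedBox ρ)
  set G := {w : (Fin d → ℝ) × (Fin d → ℝ) | δ ≤ ρ.real (spannedBox w.1 w.2)}
  have h2 : ρ.prod ρ = ((μ T)⁻¹ * (μ T)⁻¹) • (μ.prod μ).restrict (T ×ˢ T) := by
    have hρd : ρ = (μ T)⁻¹ • μ.restrict T := rfl
    rw [hρd, Measure.prod_smul_left, Measure.prod_smul_right, smul_smul, Measure.prod_restrict]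
  rw [h2, measureReal_ennreal_smul_apply, measureReal_restrict_apply hG, ENNReal.toReal_mul,
    ENNReal.toReal_inv, ← measureReal_def] at h1
  have h3 : (μ.prod μ).real (G ∩ T ×ˢ T) ≤ (μ.prod μ).real
      {w | w.1 ∈ T ∧ w.2 ∈ T ∧ δ * μ.real T ≤ μ.real (spannedBox w.1 w.2)} := by
    refine measureReal_mono ?_
    rintro w ⟨hw, hw1, hw2⟩
    refine ⟨hw1, hw2, ?_⟩
    have hw' : δ ≤ ρ.real (spannedBox w.1 w.2) := hw
    rw [hρa _ (measurableSet_spannedBox _ _), inv_mul_eq_div, le_div_iff₀ hpos] at hw'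
    exact hw'.trans (measureReal_mono Set.inter_subset_right)
  have h4 : δ * μ.real T ^ 2 ≤ (μ.prod μ).real (G ∩ T ×ˢ T) := by
    have : (μ.real T)⁻¹ * (μ.real T)⁻¹ * (μ.prod μ).real (G ∩ T ×ˢ T) =
        (μ.prod μ).real (G ∩ T ×ˢ T) / μ.real T ^ 2 := by
      field_simp
    rw [this, le_div_iff₀ (by positivity)] at h1
    exact h1
  exact h4.trans h3

/-- Removing a box from a rectangle leaves a disjoint union of `2 * d` rectangles. -/
theorem exists_partition_diff_spannedBox {d : ℕ} {T : Set (Fin d → ℝ)}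
    (hT : IsAxisAlignedRectangle T) (x y : Fin d → ℝ) :
    ∃ Q : Fin d × Bool → Set (Fin d → ℝ), (∀ i, IsAxisAlignedRectangle (Q i) ∧ Q i ⊆ T) ∧
      ∀ (μ : Measure (Fin d → ℝ)) [IsFiniteMeasure μ],
        μ.real T = μ.real (T ∩ spannedBox x y) + ∑ i, μ.real (Q i) := by
  classical
  let I : Fin d → Set ℝ := fun l => Set.Icc (min (x l) (y l)) (max (x l) (y l))
  let stage : ℕ → Set (Fin d → ℝ) := fun n => T ∩ {z | ∀ l : Fin d, l.val < n → z l ∈ I l}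
  let half : Fin d × Bool → Set (Fin d → ℝ) := fun i =>
    {z | z i.1 ∈ if i.2 then Set.Iio (min (x i.1) (y i.1)) else Set.Ioi (max (x i.1) (y i.1))}
  have hstage : ∀ n, IsAxisAlignedRectangle (stage n) := by
    intro n
    refine hT.inter ⟨fun l => if l.val < n then I l else Set.univ, fun l => ?_, ?_⟩
    · dsimp only
      split_ifs
      · exact Set.ordConnected_Icc
      · exact Set.ordConnected_univ
    · ext z
      simp only [Set.mem_ofPred_eq, Set.mem_univ_pi]
      refine forall_congr' fun l => ?_
      split_ifs with h <;> simp [h]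
  have hhalf : ∀ i, IsAxisAlignedRectangle (half i) := by
    intro i
    refine isAxisAlignedRectangle_setOf_mem i.1 ?_
    split_ifs
    · exact Set.ordConnected_Iio
    · exact Set.ordConnected_Ioi
  refine ⟨fun i => stage i.1 ∩ half i, fun i => ⟨(hstage _).inter (hhalf i), fun z hz => hz.1.1⟩,
    fun μ _ => ?_⟩
  have hstep : ∀ l : Fin d, μ.real (stage l) - μ.real (stage (l + 1)) =
      μ.real (stage l ∩ half (l, true)) + μ.real (stage l ∩ half (l, false)) := by
    intro l
    have hdiff : stage l \ stage (l + 1) =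
        (stage l ∩ half (l, true)) ∪ (stage l ∩ half (l, false)) := by
      ext z
      have h1 : z ∈ stage (l + 1) ↔ z ∈ stage l ∧ z l ∈ I l := by
        constructor
        · rintro ⟨hz, h⟩
          exact ⟨⟨hz, fun j hj => h j (by omega)⟩, h l (by omega)⟩
        · rintro ⟨⟨hz, h⟩, hl⟩
          refine ⟨hz, fun j hj => ?_⟩
          rcases Nat.lt_succ_iff_lt_or_eq.1 hj with h' | h'
          · exact h j h'
          · exact (Fin.ext h') ▸ hl
      have h2 : z l ∉ I l ↔ z l < min (x l) (y l) ∨ max (x l) (y l) < z l := by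
        simp only [I, Set.mem_Icc, not_and_or, not_le]
      simp only [Set.mem_sdiff, h1, Set.mem_union, Set.mem_inter_iff, half, if_true,
        Set.mem_ofPred_eq, Set.mem_Iio, Set.mem_Ioi, Bool.false_eq_true, if_false]
      tauto
    have hsub : stage (l + 1) ⊆ stage l := fun z hz => ⟨hz.1, fun j hj => hz.2 j (by omega)⟩
    rw [← measureReal_sdiff hsub (hstage _).measurableSet, hdiff,
      measureReal_union ?_ ((hstage _).inter (hhalf _)).measurableSet]
    refine Set.disjoint_left.2 ?_
    rintro z ⟨_, h⟩ ⟨_, h'⟩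
    simp only [half, if_true, Set.mem_ofPred_eq, Set.mem_Iio, Set.mem_Ioi, Bool.false_eq_true,
      if_false] at h h'
    exact absurd (h.trans_le (min_le_max.trans h'.le)) (lt_irrefl _)
  have htel := Finset.sum_range_sub' (fun n => μ.real (stage n)) d
  rw [Finset.sum_range (fun n => μ.real (stage n) - μ.real (stage (n + 1)))] at htel
  have h0 : stage 0 = T := by simp [stage]
  have hd : stage d = T ∩ spannedBox x y := by
    ext z
    simp [stage, spannedBox, I]
  rw [h0, hd, Finset.sum_congr rfl fun l _ => hstep l] at htel
  rw [Fintype.sum_prod_type]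
  simp only [Fintype.sum_bool]
  linarith

theorem sum_rpow_le_card_rpow_mul {ι : Type*} [Fintype ι] {f : ι → ℝ} (hf : ∀ i, 0 ≤ f i) {β : ℝ}
    (hβ0 : 0 < β) (hβ1 : β ≤ 1) :
    ∑ i, f i ^ β ≤ (Fintype.card ι : ℝ) ^ (1 - β) * (∑ i, f i) ^ β := by
  have h := Real.rpow_sum_le_const_mul_sum_rpow_of_nonneg (s := Finset.univ)
    (f := fun i => f i ^ β) (p := β⁻¹) ((one_le_inv₀ hβ0).2 hβ1)
    (fun i _ => Real.rpow_nonneg (hf i) _)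
  simp only [Real.rpow_rpow_inv (hf _) hβ0.ne', Finset.card_univ] at h
  have hs : 0 ≤ ∑ i, f i ^ β := Finset.sum_nonneg fun i _ => Real.rpow_nonneg (hf i) _
  have h2 := Real.rpow_le_rpow (Real.rpow_nonneg hs _) h hβ0.le
  rw [Real.rpow_inv_rpow hs hβ0.ne', Real.mul_rpow (by positivity)
    (Finset.sum_nonneg fun i _ => hf i), ← Real.rpow_mul (by positivity)] at h2
  rwa [show (β⁻¹ - 1) * β = 1 - β by field_simp] at h2

theorem card_rpow_mul_one_sub_rpow_le {n : ℕ} (hn : 0 < n) {δ γ : ℝ} (hδ0 : 0 < δ)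
    (hδ1 : δ ≤ 1 / 2) (hγ0 : 0 < γ) (hγ : γ * n ≤ δ / 8) :
    (n : ℝ) ^ γ * (1 - δ) ^ (1 - γ) ≤ 1 - δ / 2 := by
  have hn1 : (1 : ℝ) ≤ n := by exact_mod_cast hn
  have hn0 : (0 : ℝ) < n := by linarith
  have hγ1 : γ ≤ 1 / 16 := by nlinarith
  have h1 : (n : ℝ) ^ γ ≤ Real.exp (δ / 8) := by
    rw [Real.rpow_def_of_pos hn0]
    refine Real.exp_le_exp.2 ?_
    have := Real.log_le_sub_one_of_pos hn0
    nlinarith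
  have h2 : (1 - δ) ^ (1 - γ) ≤ Real.exp (-(15 / 16) * δ) := by
    rw [Real.rpow_def_of_pos (by linarith)]
    refine Real.exp_le_exp.2 ?_
    have := Real.log_le_sub_one_of_pos (show 0 < 1 - δ by linarith)
    nlinarith
  calc (n : ℝ) ^ γ * (1 - δ) ^ (1 - γ) ≤ Real.exp (δ / 8) * Real.exp (-(15 / 16) * δ) :=
        mul_le_mul h1 h2 (Real.rpow_nonneg (by linarith) _) (Real.exp_pos _).le
    _ ≤ Real.exp (-(3 / 4 * δ)) := by
        rw [← Real.exp_add]; exact Real.exp_le_exp.2 (by linarith)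
    _ ≤ 1 - δ / 2 := by
        rw [Real.exp_neg]
        have h3 := Real.add_one_le_exp (3 / 4 * δ)
        refine (inv_anti₀ (by linarith) h3).trans ?_
        rw [inv_le_iff_one_le_mul₀ (by linarith)]
        nlinarith

theorem abs_measureReal_sub_le {X : Type*} [MeasurableSpace X] (p q : Measure X) (T : Set X) :
    |p.real T - q.real T| ≤ p.real T + q.real T := by
  have h1 := measureReal_nonneg (μ := p) (s := T)
  have h2 := measureReal_nonneg (μ := q) (s := T)
  exact abs_le.2 ⟨by linarith, by linarith⟩

/-- A rectangle with noticeable discrepancy contains a rectangle of noticeable discrepancy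
in which every box of substantial relative mass has noticeable discrepancy. -/
theorem exists_subrectangle_forall_spannedBox {d : ℕ} (hd : 1 ≤ d) (p q : Measure (Fin d → ℝ))
    [IsFiniteMeasure p] [IsFiniteMeasure q] {P : Set (Fin d → ℝ)} (hP : IsAxisAlignedRectangle P)
    {M η δ : ℝ} (hM : 0 < M) (hη : 0 < η) (hδ0 : 0 < δ) (hδ1 : δ ≤ 1 / 2)
    (hPM : p.real P + q.real P ≤ M) (hPη : η * M ≤ |p.real P - q.real P|) :
    ∃ T ⊆ P, IsAxisAlignedRectangle T ∧
      (η / 2) ^ (16 * d / δ) * M ≤ |p.real T - q.real T| ∧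
      ∀ x ∈ T, ∀ y ∈ T,
        δ * (p.real T + q.real T) ≤ p.real (spannedBox x y) + q.real (spannedBox x y) →
        δ / 4 * ((η / 2) ^ (16 * d / δ) * M) ≤
          |p.real (spannedBox x y) - q.real (spannedBox x y)| := by
  have hd1 : (1 : ℝ) ≤ d := by exact_mod_cast hd
  set γ : ℝ := δ / (16 * d) with hγ
  have hγ0 : 0 < γ := by positivity
  have hγd : γ * (2 * d) = δ / 8 := by rw [hγ]; field_simp; norm_num
  have hγ1 : γ < 1 := by nlinarith
  set β : ℝ := 1 - γ with hβ
  have hβ0 : 0 < β := by linarith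
  set τ : ℝ := (η / 2) ^ (16 * d / δ) with hτ
  have hτγ : τ ^ γ = η / 2 := by
    rw [hτ, ← Real.rpow_mul (by positivity), hγ,
      show 16 * (d : ℝ) / δ * (δ / (16 * d)) = 1 by field_simp, Real.rpow_one]
  have hτ0 : 0 < τ := Real.rpow_pos_of_pos (by positivity) _
  let σ : Set (Fin d → ℝ) → ℝ := fun T => p.real T + q.real T
  let ν : Set (Fin d → ℝ) → ℝ := fun T => |p.real T - q.real T|
  have hσ0 : ∀ T, 0 ≤ σ T := fun T => add_nonneg measureReal_nonneg measureReal_nonneg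
  have hν0 : ∀ T, 0 ≤ ν T := fun T => abs_nonneg _
  have hνσ : ∀ T, ν T ≤ σ T := fun T => abs_measureReal_sub_le p q T
  have hsplit : ∀ a : ℝ, 0 < a → a = a ^ β * a ^ γ := fun a ha => by
    rw [← Real.rpow_add ha, hβ, sub_add_cancel, Real.rpow_one]
  let Φ : Set (Fin d → ℝ) → ℝ := fun T => ν T / σ T ^ β
  let 𝒯 : Set (Set (Fin d → ℝ)) := {T | T ⊆ P ∧ IsAxisAlignedRectangle T}
  have hbdd : BddAbove (Φ '' 𝒯) := by
    refine ⟨M ^ γ, ?_⟩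
    rintro _ ⟨T, ⟨hTP, _⟩, rfl⟩
    rcases (hσ0 T).eq_or_lt with h | h
    · have : ν T = 0 := le_antisymm (h ▸ hνσ T) (hν0 T)
      simp only [Φ, this, zero_div]
      positivity
    · have hσM : σ T ≤ M := by
        refine le_trans (add_le_add ?_ ?_) hPM <;> exact measureReal_mono hTP
      rw [div_le_iff₀ (Real.rpow_pos_of_pos h _)]
      calc ν T ≤ σ T := hνσ T
        _ = σ T ^ γ * σ T ^ β := by rw [mul_comm]; exact hsplit _ h
        _ ≤ M ^ γ * σ T ^ β := by gcongr
  set s := sSup (Φ '' 𝒯) with hs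
  have hle : ∀ T ∈ 𝒯, ν T ≤ s * σ T ^ β := by
    intro T hT
    rcases (hσ0 T).eq_or_lt with h | h
    · have : ν T = 0 := le_antisymm (h ▸ hνσ T) (hν0 T)
      rw [this, ← h, Real.zero_rpow hβ0.ne', mul_zero]
    · rw [← div_le_iff₀ (Real.rpow_pos_of_pos h _)]
      exact le_csSup hbdd ⟨T, hT, rfl⟩
  have hsη : η * M ^ γ ≤ s := by
    have hPpos : 0 < σ P := (mul_pos hη hM).trans_le (hPη.trans (hνσ P))
    have h1 : Φ P ≤ s := le_csSup hbdd ⟨P, ⟨subset_rfl, hP⟩, rfl⟩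
    refine le_trans ?_ h1
    rw [le_div_iff₀ (Real.rpow_pos_of_pos hPpos _)]
    calc η * M ^ γ * σ P ^ β ≤ η * M ^ γ * M ^ β := by gcongr
      _ = η * M := by rw [mul_assoc, mul_comm (M ^ γ), ← hsplit M hM]
      _ ≤ ν P := hPη
  have hs0 : 0 < s := (mul_pos hη (Real.rpow_pos_of_pos hM _)).trans_le hsη
  obtain ⟨_, ⟨T, hT, rfl⟩, hTs⟩ := exists_lt_of_lt_csSup (s := Φ '' 𝒯) ⟨_, P, ⟨subset_rfl, hP⟩, rfl⟩
    (show (1 - δ / 8) * s < s by nlinarith)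
  have hTpos : 0 < σ T := by
    refine lt_of_le_of_ne (hσ0 T) fun h => ?_
    have hz : ν T = 0 := le_antisymm (h ▸ hνσ T) (hν0 T)
    simp only [Φ, hz, zero_div] at hTs
    nlinarith
  have hσβ : 0 < σ T ^ β := Real.rpow_pos_of_pos hTpos _
  have hTs' : (1 - δ / 8) * s * σ T ^ β < ν T := (lt_div_iff₀ hσβ).1 hTs
  have hsσ : 0 < s * σ T ^ β := mul_pos hs0 hσβ
  have hhalf : s / 2 * σ T ^ β ≤ ν T := by nlinarith
  have hστ : τ * M ≤ σ T := by
    have h1 : s / 2 * σ T ^ β ≤ σ T ^ γ * σ T ^ β := by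
      rw [mul_comm (σ T ^ γ), ← hsplit _ hTpos]; exact hhalf.trans (hνσ T)
    have h2 : (τ * M) ^ γ ≤ σ T ^ γ := by
      rw [Real.mul_rpow hτ0.le hM.le, hτγ]
      have := le_of_mul_le_mul_right h1 hσβ
      linarith
    exact (Real.rpow_le_rpow_iff (by positivity) hTpos.le hγ0).1 h2
  have hmain : τ * M ≤ s / 2 * σ T ^ β := by
    rw [hsplit (τ * M) (by positivity), mul_comm]
    refine mul_le_mul ?_ (Real.rpow_le_rpow (by positivity) hστ hβ0.le) (by positivity)
      (by positivity)
    rw [Real.mul_rpow hτ0.le hM.le, hτγ]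
    linarith
  refine ⟨T, hT.1, hT.2, hmain.trans hhalf, fun x hx y hy hxy => ?_⟩
  obtain ⟨Q, hQ, hQμ⟩ := exists_partition_diff_spannedBox hT.2 x y
  rw [Set.inter_eq_right.2 (hT.2.spannedBox_subset hx hy)] at hQμ
  have hp := hQμ p
  have hq := hQμ q
  have hσQ : ∑ i, σ (Q i) ≤ (1 - δ) * σ T := by
    simp only [σ, Finset.sum_add_distrib]
    linarith
  have hpow : ∑ i, σ (Q i) ^ β ≤ (1 - δ / 2) * σ T ^ β := by
    have hcard : Fintype.card (Fin d × Bool) = 2 * d := by simp [mul_comm]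
    calc ∑ i, σ (Q i) ^ β ≤ ((2 * d : ℕ) : ℝ) ^ γ * (∑ i, σ (Q i)) ^ β := by
          have := sum_rpow_le_card_rpow_mul (fun i => hσ0 (Q i)) hβ0 (by linarith)
          rwa [hcard, hβ, sub_sub_cancel] at this
      _ ≤ ((2 * d : ℕ) : ℝ) ^ γ * ((1 - δ) ^ β * σ T ^ β) := by
          rw [← Real.mul_rpow (by linarith) hTpos.le]
          gcongr
      _ = (((2 * d : ℕ) : ℝ) ^ γ * (1 - δ) ^ β) * σ T ^ β := by ring
      _ ≤ (1 - δ / 2) * σ T ^ β := by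
          gcongr
          exact card_rpow_mul_one_sub_rpow_le (by omega) hδ0 hδ1 hγ0
            (by push_cast; exact hγd.le)
  have hν : ν T ≤ ν (spannedBox x y) + ∑ i, ν (Q i) := by
    have : p.real T - q.real T = (p.real (spannedBox x y) - q.real (spannedBox x y)) +
        ∑ i, (p.real (Q i) - q.real (Q i)) := by
      rw [Finset.sum_sub_distrib]; linarith
    simp only [ν, this]
    exact (abs_add_le _ _).trans (add_le_add le_rfl (Finset.abs_sum_le_sum_abs _ _))
  have hνQ : ∑ i, ν (Q i) ≤ s * ((1 - δ / 2) * σ T ^ β) := by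
    calc ∑ i, ν (Q i) ≤ ∑ i, s * σ (Q i) ^ β :=
          Finset.sum_le_sum fun i _ => hle _ ⟨(hQ i).2.trans hT.1, (hQ i).1⟩
      _ = s * ∑ i, σ (Q i) ^ β := by rw [Finset.mul_sum]
      _ ≤ _ := by gcongr
  change δ / 4 * (τ * M) ≤ ν (spannedBox x y)
  nlinarith

theorem measure_singleton_eq_zero_of_continuous {d : ℕ} (p : Measure (Fin d → ℝ))
    [IsFiniteMeasure p] {l : Fin d} (hp : Continuous fun t : ℝ => (p {x | x l ≤ t}).toReal)
    (t : ℝ) : p {x | x l = t} = 0 := by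
  have hle : ∀ s < t, p.real {x | x l = t} ≤ p.real {x | x l ≤ t} - p.real {x | x l ≤ s} := by
    intro s hs
    have hm : MeasurableSet {x : Fin d → ℝ | x l ≤ s} :=
      measurableSet_le (measurable_pi_apply l) measurable_const
    have hsub : {x : Fin d → ℝ | x l ≤ s} ⊆ {x | x l ≤ t} := fun x (hx : x l ≤ s) => hx.trans hs.le
    rw [← measureReal_sdiff hsub hm]
    refine measureReal_mono fun x hx => ?_
    have hx' : x l = t := hx
    exact ⟨hx'.le, fun h : x l ≤ s => absurd hs (not_lt.2 (hx' ▸ h))⟩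
  have hlim : Filter.Tendsto (fun s => p.real {x | x l ≤ t} - p.real {x | x l ≤ s})
      (nhdsWithin t (Set.Iio t)) (nhds (p.real {x | x l ≤ t} - p.real {x | x l ≤ t})) :=
    tendsto_const_nhds.sub (hp.continuousAt.tendsto.mono_left nhdsWithin_le_nhds)
  rw [sub_self] at hlim
  have h0 : p.real {x | x l = t} ≤ 0 :=
    ge_of_tendsto hlim (Filter.eventually_of_mem self_mem_nhdsWithin hle)
  exact (measureReal_eq_zero_iff).1 (le_antisymm h0 measureReal_nonneg)

/-- The quantile slices of an atomless finite measure on the line have mass at most `1 / k`. -/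
theorem measureReal_floor_mul_cdf_le (ρ : Measure ℝ) [IsFiniteMeasure ρ] (h0 : ∀ t, ρ {t} = 0)
    {k : ℝ} (hk : 0 < k) (j : ℕ) :
    ρ.real {t | ⌊k * ρ.real (Set.Iic t)⌋₊ = j} ≤ 1 / k := by
  have hmono : Monotone fun t => ρ.real (Set.Iic t) := fun s t hst =>
    measureReal_mono (Set.Iic_subset_Iic.2 hst)
  have hmeas : MeasurableSet {t | ⌊k * ρ.real (Set.Iic t)⌋₊ = j} :=
    (Nat.measurable_floor.comp (hmono.measurable.const_mul k)) (measurableSet_singleton j)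
  by_contra! hlt
  have hlt' : ENNReal.ofReal (1 / k) < ρ {t | ⌊k * ρ.real (Set.Iic t)⌋₊ = j} :=
    (ENNReal.ofReal_lt_iff_lt_toReal (by positivity) (measure_ne_top _ _)).2 hlt
  obtain ⟨K, hKs, hK, hKlt⟩ := hmeas.exists_lt_isCompact hlt'
  have hne : K.Nonempty := by
    refine Set.nonempty_iff_ne_empty.2 fun h => ?_
    simp [h] at hKlt
  have hs : ⌊k * ρ.real (Set.Iic (sInf K))⌋₊ = j := hKs (hK.sInf_mem hne)
  have ht : ⌊k * ρ.real (Set.Iic (sSup K))⌋₊ = j := hKs (hK.sSup_mem hne)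
  have hst : sInf K ≤ sSup K := Real.sInf_le_sSup K hK.bddBelow hK.bddAbove
  have hsub : K ⊆ {sInf K} ∪ (Set.Iic (sSup K) \ Set.Iic (sInf K)) := by
    intro x hx
    rcases (csInf_le hK.bddBelow hx).eq_or_lt with h | h
    · exact Or.inl h.symm
    · exact Or.inr ⟨le_csSup hK.bddAbove hx, not_le.2 h⟩
  have h1 : ρ.real K ≤ ρ.real (Set.Iic (sSup K)) - ρ.real (Set.Iic (sInf K)) := by
    refine (measureReal_mono hsub).trans ((measureReal_union_le _ _).trans ?_)
    rw [measureReal_sdiff (Set.Iic_subset_Iic.2 hst) measurableSet_Iic, measureReal_def, h0]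
    simp
  have h2 : 1 / k < ρ.real K := (ENNReal.ofReal_lt_iff_lt_toReal (by positivity)
    (measure_ne_top _ _)).1 hKlt
  have h3 := Nat.floor_le (mul_nonneg hk.le (measureReal_nonneg (μ := ρ) (s := Set.Iic (sInf K))))
  have h4 := Nat.lt_floor_add_one (k * ρ.real (Set.Iic (sSup K)))
  rw [hs] at h3
  rw [ht] at h4
  have h5 : k * (1 / k) = 1 := by field_simp
  nlinarith

/-- A rectangle can be cut along one coordinate into slices of mass at most `1 / k`. -/
theorem exists_slices {d : ℕ} (l : Fin d) (σ : Measure (Fin d → ℝ)) [IsFiniteMeasure σ]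
    (h0 : ∀ t, σ {x | x l = t} = 0) {R : Set (Fin d → ℝ)} (hR : IsAxisAlignedRectangle R)
    {k : ℝ} (hk : 0 < k) :
    ∃ Q : Fin (⌊k * σ.real R⌋₊ + 1) → Set (Fin d → ℝ), (∀ j, IsAxisAlignedRectangle (Q j)) ∧
      (∀ j, σ.real (Q j) ≤ 1 / k) ∧ Pairwise (fun i j => Disjoint (Q i) (Q j)) ∧
      ⋃ j, Q j = R := by
  let ρ : Measure ℝ := (σ.restrict R).map fun x => x l
  have hρ : ∀ s, MeasurableSet s → ρ.real s = σ.real (R ∩ {x | x l ∈ s}) := by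
    intro s hs
    simp only [ρ]
    rw [map_measureReal_apply (measurable_pi_apply l) hs,
      measureReal_restrict_apply (measurable_pi_apply l hs), Set.inter_comm]
    rfl
  have hρ0 : ∀ t, ρ {t} = 0 := by
    intro t
    refine (measureReal_eq_zero_iff).1 ?_
    rw [hρ _ (measurableSet_singleton t)]
    refine (measureReal_eq_zero_iff).2 (measure_mono_null ?_ (h0 t))
    exact fun x hx => hx.2
  have hmono : Monotone fun t => ⌊k * ρ.real (Set.Iic t)⌋₊ := fun s t hst =>
    Nat.floor_mono (mul_le_mul_of_nonneg_left
      (measureReal_mono (Set.Iic_subset_Iic.2 hst)) hk.le)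
  have hconn : ∀ j : ℕ, Set.OrdConnected {t | ⌊k * ρ.real (Set.Iic t)⌋₊ = j} := fun j =>
    ⟨fun s hs t ht u hu => le_antisymm ((hmono hu.2).trans_eq ht) ((hmono hu.1).trans_eq' hs)⟩
  refine ⟨fun j => R ∩ {x | x l ∈ {t | ⌊k * ρ.real (Set.Iic t)⌋₊ = j.val}},
    fun j => hR.inter (isAxisAlignedRectangle_setOf_mem l (hconn j)), fun j => ?_, ?_, ?_⟩
  · rw [← hρ _ (hconn j).measurableSet]
    exact measureReal_floor_mul_cdf_le ρ hρ0 hk j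
  · intro i j hij
    refine Set.disjoint_left.2 fun x hx hx' => hij (Fin.ext ?_)
    exact (hx.2 : _ = i.val).symm.trans hx'.2
  · ext x
    simp only [Set.mem_iUnion, Set.mem_inter_iff, exists_and_left, and_iff_left_iff_imp]
    intro _
    refine ⟨⟨⌊k * ρ.real (Set.Iic (x l))⌋₊, Nat.lt_succ_of_le (Nat.floor_mono ?_)⟩, rfl⟩
    refine mul_le_mul_of_nonneg_left ?_ hk.le
    rw [hρ _ measurableSet_Iic]
    exact measureReal_mono Set.inter_subset_left

/-- Disjoint rectangles can be refined to at most `3 * k` rectangles of mass at most `1 / k`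
without decreasing the total discrepancy. -/
theorem exists_refinement {d k : ℕ} (hk : 0 < k) (l : Fin d) (p q : Measure (Fin d → ℝ))
    [IsProbabilityMeasure p] [IsProbabilityMeasure q] (hp : ∀ t, p {x | x l = t} = 0)
    (hq : ∀ t, q {x | x l = t} = 0) {R : Fin k → Set (Fin d → ℝ)}
    (hR : ∀ i, IsAxisAlignedRectangle (R i)) (hdisj : Pairwise fun i j => Disjoint (R i) (R j)) :
    ∃ (ι : Type) (_ : Fintype ι) (P : ι → Set (Fin d → ℝ)), Fintype.card ι ≤ 3 * k ∧
      (∀ i, IsAxisAlignedRectangle (P i)) ∧ Pairwise (fun i j => Disjoint (P i) (P j)) ∧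
      (∀ i, p.real (P i) + q.real (P i) ≤ 1 / k) ∧
      ∑ i, |p.real (R i) - q.real (R i)| ≤ ∑ i, |p.real (P i) - q.real (P i)| := by
  have hk' : (0 : ℝ) < k := by exact_mod_cast hk
  have hσ : ∀ s, (p + q).real s = p.real s + q.real s := fun s => measureReal_add_apply
  have h0 : ∀ t, (p + q) {x | x l = t} = 0 := fun t => by
    rw [Measure.add_apply, hp, hq, add_zero]
  choose Q hQ1 hQ2 hQ3 hQ4 using fun i => exists_slices l (p + q) h0 (hR i) hk'
  refine ⟨Σ i : Fin k, Fin (⌊(k : ℝ) * (p + q).real (R i)⌋₊ + 1), inferInstance,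
    fun e => Q e.1 e.2, ?_, fun e => hQ1 _ _, ?_, fun e => ?_, ?_⟩
  · have h1 : ∑ i, (p + q).real (R i) ≤ 2 := by
      rw [← measureReal_iUnion_fintype (fun i j hij => hdisj hij)
        (fun i => (hR i).measurableSet), hσ]
      linarith [measureReal_le_one (μ := p) (s := ⋃ i, R i),
        measureReal_le_one (μ := q) (s := ⋃ i, R i)]
    have h2 : ((Fintype.card (Σ i : Fin k, Fin (⌊(k : ℝ) * (p + q).real (R i)⌋₊ + 1)) : ℕ) : ℝ) ≤
        (3 * k : ℕ) := by
      simp only [Fintype.card_sigma, Fintype.card_fin, Nat.cast_sum, Nat.cast_add, Nat.cast_one,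
        Nat.cast_mul, Nat.cast_ofNat]
      calc ∑ i, ((⌊(k : ℝ) * (p + q).real (R i)⌋₊ : ℝ) + 1)
          ≤ ∑ i, ((k : ℝ) * (p + q).real (R i) + 1) := Finset.sum_le_sum fun i _ => by
            gcongr; exact Nat.floor_le (by positivity)
        _ = k * ∑ i, (p + q).real (R i) + k := by
            rw [Finset.sum_add_distrib, Finset.mul_sum]; simp
        _ ≤ 3 * k := by nlinarith
    exact_mod_cast h2
  · rintro ⟨i, a⟩ ⟨j, b⟩ hne
    by_cases hij : i = j
    · subst hij
      exact hQ3 i fun h => hne (congrArg (Sigma.mk i) h)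
    · refine (hdisj hij).mono ?_ ?_
      · rw [← hQ4 i]; exact Set.subset_iUnion (Q i) a
      · rw [← hQ4 j]; exact Set.subset_iUnion (Q j) b
  · rw [← hσ]; exact hQ2 _ _
  · rw [Fintype.sum_sigma]
    refine Finset.sum_le_sum fun i _ => ?_
    have hsum : ∀ (μ : Measure (Fin d → ℝ)) [IsFiniteMeasure μ],
        μ.real (R i) = ∑ j, μ.real (Q i j) := fun μ _ => by
      rw [← measureReal_iUnion_fintype (fun a b hab => hQ3 i hab)
        (fun j => (hQ1 i j).measurableSet), hQ4 i]
    rw [hsum p, hsum q, ← Finset.sum_sub_distrib]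
    exact Finset.abs_sum_le_sum_abs _ _

/-- A large `A_k` distance yields many disjoint light rectangles of noticeable discrepancy in
each of which every box of substantial relative mass has noticeable discrepancy. -/
theorem exists_many_rectangles {d k : ℕ} (hk : 0 < k) (l : Fin d) (p q : Measure (Fin d → ℝ))
    [IsProbabilityMeasure p] [IsProbabilityMeasure q] (hp : ∀ t, p {x | x l = t} = 0)
    (hq : ∀ t, q {x | x l = t} = 0) {ε δ : ℝ} (hε : 0 < ε) (hA : ε ≤ AkDist k p q)
    (hδ0 : 0 < δ) (hδ1 : δ ≤ 1 / 2) :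
    ∃ (ι : Type) (_ : Fintype ι) (T : ι → Set (Fin d → ℝ)), Fintype.card ι ≤ 3 * k ∧
      ε * k / 4 ≤ Fintype.card ι ∧ (∀ i, IsAxisAlignedRectangle (T i)) ∧
      Pairwise (fun i j => Disjoint (T i) (T j)) ∧
      (∀ i, p.real (T i) + q.real (T i) ≤ 1 / k) ∧
      (∀ i, (ε / 24) ^ (16 * d / δ) / k ≤ |p.real (T i) - q.real (T i)|) ∧
      ∀ i, ∀ x ∈ T i, ∀ y ∈ T i,
        δ * (p.real (T i) + q.real (T i)) ≤ p.real (spannedBox x y) + q.real (spannedBox x y) →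
        δ / 4 * ((ε / 24) ^ (16 * d / δ) / k) ≤
          |p.real (spannedBox x y) - q.real (spannedBox x y)| := by
  classical
  have hk' : (0 : ℝ) < k := by exact_mod_cast hk
  obtain ⟨R, hRε⟩ : ∃ R : {R : Fin k → Set (Fin d → ℝ) // (∀ i, IsAxisAlignedRectangle (R i)) ∧
      Pairwise fun i j => Disjoint (R i) (R j)},
      ε / 2 < ∑ i, |p.real (R.1 i) - q.real (R.1 i)| := by
    by_contra! h
    have : AkDist k p q ≤ ε / 2 := Real.iSup_le h (by positivity)
    linarith
  obtain ⟨ι, _, P, hcard, hrect, hdisj, hmass, hsum⟩ :=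
    exists_refinement hk l p q hp hq R.2.1 R.2.2
  let good : ι → Prop := fun i => ε / 12 * (1 / k) ≤ |p.real (P i) - q.real (P i)|
  have hgood : ∀ i : {i // good i}, _ := fun i =>
    exists_subrectangle_forall_spannedBox l.pos p q (hrect i) (M := 1 / k) (η := ε / 12)
      (by positivity) (by positivity) hδ0 hδ1 (hmass i) i.2
  rw [show ε / 12 / 2 = ε / 24 by ring] at hgood
  simp only [mul_one_div] at hgood
  choose T hTP hTr hTν hTB using hgood
  refine ⟨{i // good i}, inferInstance, T, (Fintype.card_subtype_le _).trans hcard, ?_, hTr,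
    fun i j hij => (hdisj fun h => hij (Subtype.ext h)).mono (hTP i) (hTP j),
    fun i => le_trans (add_le_add (measureReal_mono (hTP i)) (measureReal_mono (hTP i)))
      (hmass i), hTν, hTB⟩
  have hbound : ∀ i, |p.real (P i) - q.real (P i)| ≤
      ε / 12 * (1 / k) + if good i then 1 / (k : ℝ) else 0 := by
    intro i
    split_ifs with h
    · have := (abs_measureReal_sub_le p q (P i)).trans (hmass i)
      have : 0 < ε / 12 * (1 / (k : ℝ)) := by positivity
      linarith
    · rw [add_zero]; exact (not_le.1 h).le
  have h1 := hsum.trans (Finset.sum_le_sum fun i _ => hbound i)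
  rw [Finset.sum_add_distrib, ← Finset.sum_filter, Finset.sum_const, Finset.sum_const,
    ← Fintype.card_subtype, Finset.card_univ, nsmul_eq_mul, nsmul_eq_mul] at h1
  have h2 : (Fintype.card ι : ℝ) * (ε / 12 * (1 / k)) ≤ 3 * k * (ε / 12 * (1 / k)) := by
    gcongr; exact_mod_cast hcard
  have h3 : 3 * k * (ε / 12 * (1 / k)) = ε / 4 := by field_simp; norm_num
  have h4 : ε / 4 ≤ (Fintype.card {i // good i} : ℝ) * (1 / k) := by linarith
  rw [mul_one_div, le_div_iff₀ hk'] at h4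
  linarith

theorem integral_ncard_sq_eq_sum {Ω ι : Type*} [MeasurableSpace Ω] [Fintype ι] (P : Measure Ω)
    [IsFiniteMeasure P] {A : ι → Set Ω} (hA : ∀ i, MeasurableSet (A i)) :
    Integrable (fun ω => ({i | ω ∈ A i}.ncard : ℝ) ^ 2) P ∧
      ∫ ω, ({i | ω ∈ A i}.ncard : ℝ) ^ 2 ∂P = ∑ i, ∑ j, P.real (A i ∩ A j) := by
  have h := integral_ncard_eq_sum P (A := fun e : ι × ι => A e.1 ∩ A e.2)
    fun e => (hA _).inter (hA _)
  have h2 : ∀ ω, ({e : ι × ι | ω ∈ A e.1 ∩ A e.2}.ncard : ℝ) = ({i | ω ∈ A i}.ncard : ℝ) ^ 2 := by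
    intro ω
    have : {e : ι × ι | ω ∈ A e.1 ∩ A e.2} = {i | ω ∈ A i} ×ˢ {i | ω ∈ A i} := rfl
    rw [this, Set.ncard_prod, sq, Nat.cast_mul]
  simp only [h2, Fintype.sum_prod_type] at h
  exact h

/-- Second moment lower tail bound for the number of events that occur. -/
theorem measureReal_ncard_lt_half_le {Ω ι : Type*} [MeasurableSpace Ω] [Fintype ι]
    (P : Measure Ω) [IsProbabilityMeasure P] {A : ι → Set Ω} (hA : ∀ i, MeasurableSet (A i))
    {m : ℝ} (hm : 0 < m) (hmean : ∑ i, P.real (A i) = m)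
    (hvar : ∑ i, ∑ j, P.real (A i ∩ A j) ≤ m ^ 2 + 2 * m) :
    P.real {ω | ({i | ω ∈ A i}.ncard : ℝ) < m / 2} ≤ 8 / m := by
  obtain ⟨hi1, he1⟩ := integral_ncard_eq_sum P hA
  obtain ⟨hi2, he2⟩ := integral_ncard_sq_eq_sum P hA
  set N : Ω → ℝ := fun ω => ({i | ω ∈ A i}.ncard : ℝ) with hN
  have hsq : (fun ω => (N ω - m) ^ 2) = fun ω => N ω ^ 2 - (2 * m * N ω - m ^ 2) := by
    funext ω; ring
  have hi3 : Integrable (fun ω => 2 * m * N ω - m ^ 2) P :=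
    (hi1.const_mul _).sub (integrable_const _)
  have hN_int : Integrable (fun ω => (N ω - m) ^ 2) P := by
    rw [hsq]; exact hi2.sub hi3
  have hval : ∫ ω, (N ω - m) ^ 2 ∂P ≤ 2 * m := by
    rw [hsq, integral_sub hi2 hi3, integral_sub (hi1.const_mul _) (integrable_const _),
      integral_const_mul, he1, he2, hmean]
    simp only [integral_const, probReal_univ, one_smul]
    nlinarith
  have hmarkov := mul_meas_ge_le_integral_of_nonneg
    (Filter.Eventually.of_forall fun ω => sq_nonneg (N ω - m)) hN_int (m ^ 2 / 4)
  have hsub : P.real {ω | N ω < m / 2} ≤ P.real {ω | m ^ 2 / 4 ≤ (N ω - m) ^ 2} := by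
    refine measureReal_mono fun ω hω => ?_
    have hω' : N ω < m / 2 := hω
    change m ^ 2 / 4 ≤ (N ω - m) ^ 2
    nlinarith
  rw [le_div_iff₀ hm]
  have h1 : m ^ 2 / 4 * P.real {ω | N ω < m / 2} ≤ 2 * m :=
    (mul_le_mul_of_nonneg_left hsub (by positivity)).trans (hmarkov.trans hval)
  have h2 : m / 4 * (P.real {ω | N ω < m / 2} * m) ≤ m / 4 * 8 := by linarith
  exact le_of_mul_le_mul_left h2 (by positivity)

theorem measureReal_lt_ncard_le {Ω ι : Type*} [MeasurableSpace Ω] [Fintype ι]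
    (P : Measure Ω) [IsProbabilityMeasure P] {A : ι → Set Ω} (hA : ∀ i, MeasurableSet (A i))
    {m r : ℝ} (hr : 0 < r) (hmean : ∑ i, P.real (A i) ≤ m) :
    P.real {ω | r < ({i | ω ∈ A i}.ncard : ℝ)} ≤ m / r := by
  obtain ⟨hi1, he1⟩ := integral_ncard_eq_sum P hA
  have h := mul_meas_ge_le_integral_of_nonneg
    (Filter.Eventually.of_forall fun ω => Nat.cast_nonneg (α := ℝ) {i | ω ∈ A i}.ncard) hi1 r
  rw [he1] at h
  rw [le_div_iff₀ hr, mul_comm]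
  refine le_trans (mul_le_mul_of_nonneg_left (measureReal_mono fun ω hω => ?_) hr.le)
    (h.trans hmean)
  have hω' : r < ({i | ω ∈ A i}.ncard : ℝ) := hω
  exact hω'.le

/-- Among i.i.d. samples, with good probability many pairs of samples are good for pairwise
distinct cells. -/
theorem le_prob_many_good_pairs {E ι κ : Type*} [MeasurableSpace E] [Fintype ι] [Fintype κ]
    (μ : Measure E) [IsProbabilityMeasure μ] {T : ι → Set E} {G : ι → Set (E × E)}
    (hT : ∀ i, MeasurableSet (T i)) (hG : ∀ i, MeasurableSet (G i))
    (hdisj : Pairwise fun i j => Disjoint (T i) (T j)) (hGT : ∀ i, G i ⊆ T i ×ˢ T i)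
    {k g : ℝ} (hk : 0 < k) (hμT : ∀ i, μ.real (T i) ≤ 1 / (2 * k))
    (hg : ∑ i, (μ.prod μ).real (G i) = g) (hg0 : 0 < g) {h : ℕ} (h0 : 0 < h) (hhk : h ≤ k)
    {w : Fin h ⊕ Fin h → κ} (hw : Function.Injective w) :
    1 - (8 / (h ^ 2 * g) + 4 * h / k) ≤ (Measure.pi fun _ : κ => μ).real
      {x | ∃ (s : Finset (Fin h × Fin h)) (j : Fin h × Fin h → ι), Set.InjOn j s ∧
        (∀ e ∈ s, (x (w (.inl e.1)), x (w (.inr e.2))) ∈ G (j e)) ∧ h ^ 2 * g / 4 ≤ s.card} := by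
  classical
  set P := Measure.pi fun _ : κ => μ
  have hTinj : ∀ {i j : ι} {z : E}, z ∈ T i → z ∈ T j → i = j := fun {i j z} hi hj => by
    by_contra hne
    exact Set.disjoint_left.1 (hdisj hne) hi hj
  have h0' : (0 : ℝ) < h := by exact_mod_cast h0
  let U : Set (E × E) := ⋃ i, G i
  let D : Set ((E × E) × E) := ⋃ i, G i ×ˢ T i
  have hU : MeasurableSet U := MeasurableSet.iUnion hG
  have hD : MeasurableSet D := MeasurableSet.iUnion fun i => (hG i).prod (hT i)
  have hUg : (μ.prod μ).real U = g := by
    rw [← hg]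
    refine measureReal_iUnion_fintype (fun i j hij => ?_) hG
    refine Set.disjoint_left.2 fun z hi hj => hij (hTinj (hGT i hi).1 (hGT j hj).1)
  have hDg : ((μ.prod μ).prod μ).real D ≤ g / (2 * k) := by
    refine (measureReal_iUnion_fintype_le _).trans ?_
    rw [← hg, Finset.sum_div]
    refine Finset.sum_le_sum fun i _ => ?_
    rw [measureReal_prod_prod, div_eq_mul_one_div]
    exact mul_le_mul_of_nonneg_left (hμT i) measureReal_nonneg
  let A : Fin h × Fin h → Set (κ → E) := fun e =>
    (fun x => (x (w (.inl e.1)), x (w (.inr e.2)))) ⁻¹' U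
  let B : (Fin h × Fin h) × (Fin h ⊕ Fin h) → Set (κ → E) := fun t =>
    if t.2 = .inl t.1.1 ∨ t.2 = .inr t.1.2 then ∅ else
      (fun x => ((x (w (.inl t.1.1)), x (w (.inr t.1.2))), x (w t.2))) ⁻¹' D
  have hpair : ∀ a b : κ, Measurable fun x : κ → E => (x a, x b) := fun a b => by fun_prop
  have htriple : ∀ a b c : κ, Measurable fun x : κ → E => ((x a, x b), x c) :=
    fun a b c => by fun_prop
  have hA : ∀ e, MeasurableSet (A e) := fun e => hpair _ _ hU
  have hB : ∀ t, MeasurableSet (B t) := by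
    intro t
    simp only [B]
    split_ifs
    · exact MeasurableSet.empty
    · exact htriple _ _ _ hD
  have hAg : ∀ e, P.real (A e) = g := by
    intro e
    rw [← hUg, ← map_pair_pi μ (hw.ne (Sum.inl_ne_inr : Sum.inl e.1 ≠ Sum.inr e.2)),
      map_measureReal_apply (hpair _ _) hU]
  have hDP : ∀ {a b c : κ}, a ≠ b → a ≠ c → b ≠ c →
      P.real ((fun x => ((x a, x b), x c)) ⁻¹' D) ≤ g / (2 * k) := by
    intro a b c hab hac hbc
    rwa [← map_measureReal_apply (htriple _ _ _) hD, map_triple_pi μ hab hac hbc]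
  have hBg : ∀ t, P.real (B t) ≤ g / (2 * k) := by
    intro t
    simp only [B]
    split_ifs with h
    · simp only [measureReal_empty]; positivity
    · rw [not_or] at h
      exact hDP (hw.ne Sum.inl_ne_inr) (hw.ne (Ne.symm h.1)) (hw.ne (Ne.symm h.2))
  have hAA : ∀ e f, P.real (A e ∩ A f) ≤ g ^ 2 + (if e = f then g else 0) +
      ((if e.1 = f.1 then g / (2 * k) else 0) + if e.2 = f.2 then g / (2 * k) else 0) := by
    rintro ⟨a, b⟩ ⟨a', b'⟩
    have hgk : 0 ≤ g / (2 * k) := by positivity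
    have hif1 : 0 ≤ if a = a' then g / (2 * k) else 0 := by split_ifs <;> simp [hgk]
    have hif2 : 0 ≤ if b = b' then g / (2 * k) else 0 := by split_ifs <;> simp [hgk]
    have hif3 : 0 ≤ if (a, b) = (a', b') then g else 0 := by split_ifs <;> simp [hg0.le]
    dsimp only
    by_cases ha : a = a'
    · subst ha
      by_cases hb : b = b'
      · subst hb
        rw [Set.inter_self, hAg]
        simp only [if_true] at hif1 hif2 ⊢
        nlinarith
      · have hsub : A (a, b) ∩ A (a, b') ⊆
            (fun x => ((x (w (.inl a)), x (w (.inr b))), x (w (.inr b')))) ⁻¹' D := by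
          rintro x ⟨h1, h2⟩
          obtain ⟨i, hi⟩ := Set.mem_iUnion.1 h1
          obtain ⟨j, hj⟩ := Set.mem_iUnion.1 h2
          obtain rfl : i = j := hTinj (hGT i hi).1 (hGT j hj).1
          exact Set.mem_iUnion.2 ⟨i, hi, (hGT i hj).2⟩
        have := (measureReal_mono hsub).trans (hDP (hw.ne Sum.inl_ne_inr) (hw.ne Sum.inl_ne_inr)
          (hw.ne fun h => hb (Sum.inr_injective h)))
        rw [if_pos rfl]
        nlinarith
    · by_cases hb : b = b'
      · subst hb
        have hsub : A (a, b) ∩ A (a', b) ⊆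
            (fun x => ((x (w (.inl a)), x (w (.inr b))), x (w (.inl a')))) ⁻¹' D := by
          rintro x ⟨h1, h2⟩
          obtain ⟨i, hi⟩ := Set.mem_iUnion.1 h1
          obtain ⟨j, hj⟩ := Set.mem_iUnion.1 h2
          obtain rfl : i = j := hTinj (hGT i hi).2 (hGT j hj).2
          exact Set.mem_iUnion.2 ⟨i, hi, (hGT i hj).1⟩
        have := (measureReal_mono hsub).trans (hDP (hw.ne Sum.inl_ne_inr)
          (hw.ne fun h => ha (Sum.inl_injective h)) (hw.ne Sum.inr_ne_inl))
        rw [if_pos rfl]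
        nlinarith
      · have heq : A (a, b) ∩ A (a', b') = (fun x => ((x (w (.inl a)), x (w (.inr b))),
            (x (w (.inl a')), x (w (.inr b'))))) ⁻¹' (U ×ˢ U) := rfl
        rw [heq, ← map_measureReal_apply (by fun_prop) (hU.prod hU),
          map_quadruple_pi μ (hw.ne Sum.inl_ne_inr) (hw.ne Sum.inl_ne_inr)
            (hw.ne fun h => ha (Sum.inl_injective h)) (hw.ne Sum.inl_ne_inr)
            (hw.ne Sum.inr_ne_inl) (hw.ne fun h => hb (Sum.inr_injective h)),
          measureReal_prod_prod, hUg]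
        nlinarith
  set m : ℝ := h ^ 2 * g with hm
  have hm0 : 0 < m := by positivity
  have hmean : ∑ e, P.real (A e) = m := by
    simp only [hAg, Finset.sum_const, Finset.card_univ, Fintype.card_prod, Fintype.card_fin,
      nsmul_eq_mul, hm]
    push_cast; ring
  have hhk' : h * (h ^ 2 * g) / k ≤ m := by
    rw [div_le_iff₀ hk]; nlinarith
  have hvar : ∑ e, ∑ f, P.real (A e ∩ A f) ≤ m ^ 2 + 2 * m := by
    refine (Finset.sum_le_sum fun e _ => Finset.sum_le_sum fun f _ => hAA e f).trans ?_
    have hdiag : ∑ e : Fin h × Fin h, ∑ f : Fin h × Fin h, (if e = f then g else 0) =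
        h * h * g := by
      simp
    have hfst : ∀ c : ℝ, ∑ e : Fin h × Fin h, ∑ f : Fin h × Fin h,
        (if e.1 = f.1 then c else 0) = h * h * h * c := by
      intro c
      simp only [Fintype.sum_prod_type_right, Finset.sum_ite_eq, Finset.mem_univ, if_true,
        Finset.sum_const, Finset.card_univ, Fintype.card_prod, Fintype.card_fin, nsmul_eq_mul]
      push_cast
      ring
    have hsnd : ∀ c : ℝ, ∑ e : Fin h × Fin h, ∑ f : Fin h × Fin h,
        (if e.2 = f.2 then c else 0) = h * h * h * c := by
      intro c
      simp only [Fintype.sum_prod_type, Finset.sum_ite_eq, Finset.mem_univ, if_true,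
        Finset.sum_const, Finset.card_univ, Fintype.card_prod, Fintype.card_fin, nsmul_eq_mul]
      push_cast
      ring
    simp only [Finset.sum_add_distrib, hdiag, hfst, hsnd, Finset.sum_const, Finset.card_univ,
      Fintype.card_prod, Fintype.card_fin, nsmul_eq_mul]
    push_cast
    have : (h : ℝ) * h * (h * h * g ^ 2) + h * h * g +
        (h * h * h * (g / (2 * k)) + h * h * h * (g / (2 * k))) =
        m ^ 2 + m + h * (h ^ 2 * g) / k := by
      rw [hm]; field_simp; ring
    linarith
  have hbad1 := measureReal_ncard_lt_half_le P hA hm0 hmean hvar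
  have hbad2 : P.real {x | m / 4 < ({t | x ∈ B t}.ncard : ℝ)} ≤ 4 * h / k := by
    refine (measureReal_lt_ncard_le P hB (m := h * m / k) (by positivity) ?_).trans_eq ?_
    · refine (Finset.sum_le_sum fun t _ => hBg t).trans_eq ?_
      simp only [Finset.sum_const, Finset.card_univ, Fintype.card_prod, Fintype.card_sum,
        Fintype.card_fin, nsmul_eq_mul, hm]
      push_cast; field_simp; ring
    · field_simp
  set good : Set (κ → E) := {x | ∃ (s : Finset (Fin h × Fin h)) (j : Fin h × Fin h → ι),
    Set.InjOn j s ∧ (∀ e ∈ s, (x (w (.inl e.1)), x (w (.inr e.2))) ∈ G (j e)) ∧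
    m / 4 ≤ s.card} with hgood
  have hcover : (Set.univ : Set (κ → E)) ⊆ good ∪
      ({x | ({e | x ∈ A e}.ncard : ℝ) < m / 2} ∪ {x | m / 4 < ({t | x ∈ B t}.ncard : ℝ)}) := by
    intro x _
    by_contra hx
    simp only [Set.mem_union, Set.mem_ofPred_eq, not_or, not_lt] at hx
    obtain ⟨hxg, hxA, hxB⟩ := hx
    apply hxg
    let s : Finset (Fin h × Fin h) := {e | x ∈ A e ∧ ∀ c, x ∉ B (e, c)}
    have hsA : ∀ e ∈ s, ∃ i, (x (w (.inl e.1)), x (w (.inr e.2))) ∈ G i := fun e he =>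
      Set.mem_iUnion.1 (Finset.mem_filter.1 he).2.1
    have : Nonempty ι := by
      by_contra hι
      rw [not_nonempty_iff] at hι
      simp at hg
      linarith
    choose! j hj using hsA
    have hjf : ∀ e ∈ s, ∀ c, x (w c) ∈ T (j e) → c = .inl e.1 ∨ c = .inr e.2 := by
      intro e he c hc
      by_contra hne
      refine (Finset.mem_filter.1 he).2.2 c ?_
      simp only [B, if_neg hne]
      exact Set.mem_iUnion.2 ⟨j e, hj e he, hc⟩
    refine ⟨s, j, ?_, hj, ?_⟩
    · intro e he f hf hef
      have h1 := hjf e he (.inl f.1) (hef ▸ (hGT _ (hj f hf)).1)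
      have h2 := hjf e he (.inr f.2) (hef ▸ (hGT _ (hj f hf)).2)
      simp only [Sum.inl.injEq, reduceCtorEq, or_false, Sum.inr.injEq, false_or] at h1 h2
      exact Prod.ext h1.symm h2.symm
    · have hle : {e | x ∈ A e}.ncard ≤ s.card + {t | x ∈ B t}.ncard := by
        have hsub : {e | x ∈ A e} ⊆ (s : Set (Fin h × Fin h)) ∪ Prod.fst '' {t | x ∈ B t} := by
          intro e he
          by_cases hB' : ∃ c, x ∈ B (e, c)
          · obtain ⟨c, hc⟩ := hB'
            exact Or.inr ⟨(e, c), hc, rfl⟩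
          · refine Or.inl ?_
            rw [not_exists] at hB'
            exact Finset.mem_coe.2 (Finset.mem_filter.2 ⟨Finset.mem_univ _, he, hB'⟩)
        refine (Set.ncard_le_ncard hsub).trans ((Set.ncard_union_le _ _).trans ?_)
        rw [Set.ncard_coe_finset]
        exact Nat.add_le_add_left Set.ncard_image_le _
      have hle' : ({e | x ∈ A e}.ncard : ℝ) ≤ s.card + {t | x ∈ B t}.ncard := by
        exact_mod_cast hle
      linarith
  have htotal : 1 ≤ P.real good + (8 / m + 4 * h / k) := by
    calc (1 : ℝ) = P.real Set.univ := probReal_univ.symm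
      _ ≤ _ := measureReal_mono hcover
      _ ≤ _ := measureReal_union_le _ _
      _ ≤ _ := by
        gcongr
        exact (measureReal_union_le _ _).trans (add_le_add hbad1 hbad2)
  linarith

theorem sum_range_poisson_le {m h : ℕ} (hm : 8 * h ≤ m) :
    ∑ n ∈ Finset.range (2 * h), Real.exp (-m) * (m : ℝ) ^ n / n.factorial ≤
      Real.exp (-(m / 4)) := by
  have h1 : ∀ n ∈ Finset.range (2 * h), Real.exp (-m) * (m : ℝ) ^ n / n.factorial ≤
      2 ^ (2 * h) * Real.exp (-m) * (((m : ℝ) / 2) ^ n / n.factorial) := by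
    intro n hn
    have h2 : (2 : ℝ) ^ n ≤ 2 ^ (2 * h) :=
      pow_le_pow_right₀ one_le_two (Finset.mem_range.1 hn).le
    have h3 : Real.exp (-m) * (m : ℝ) ^ n / n.factorial =
        2 ^ n * (Real.exp (-m) * (((m : ℝ) / 2) ^ n / n.factorial)) := by
      rw [div_pow]; field_simp
    rw [h3, mul_assoc]
    exact mul_le_mul_of_nonneg_right h2 (by positivity)
  refine (Finset.sum_le_sum h1).trans ?_
  rw [← Finset.mul_sum]
  have h4 : (2 : ℝ) ^ (2 * h) ≤ Real.exp (m / 4) := by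
    have h5 : (2 : ℝ) ≤ Real.exp 1 := by linarith [Real.add_one_le_exp 1]
    refine (pow_le_pow_left₀ zero_le_two h5 _).trans ?_
    rw [← Real.exp_nat_mul, Real.exp_le_exp]
    have : (8 : ℝ) * h ≤ m := by exact_mod_cast hm
    push_cast; linarith
  calc _ ≤ Real.exp (m / 4) * Real.exp (-m) * Real.exp (m / 2) := by
        gcongr
        exact Real.sum_le_exp_of_nonneg (by positivity) _
    _ = _ := by rw [← Real.exp_add, ← Real.exp_add]; ring_nf

/-- An event that is likely given any large enough number of samples is likely under
Poissonized sampling. -/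
theorem le_iidPoissonSamples {X : Type*} [MeasurableSpace X] (ν : Measure X)
    [IsProbabilityMeasure ν] {m h : ℕ} (hm : 8 * h ≤ m) (E : Set (Σ n : ℕ, Fin n → X)) {r : ℝ}
    (hr : 0 ≤ r)
    (hE : ∀ n, 2 * h ≤ n → r ≤ (Measure.pi fun _ : Fin n => ν).real {x | ⟨n, x⟩ ∈ E}) :
    ENNReal.ofReal ((1 - Real.exp (-(m / 4))) * r) ≤ iidPoissonSamples m ν E := by
  set P : ℕ → ℝ≥0∞ := fun n => ProbabilityTheory.poissonPMF m n with hP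
  have hsplit : ∑' n, P n = ∑ n ∈ Finset.range (2 * h), P n +
      ∑' n, (if n < 2 * h then 0 else P n) := by
    have hfin : ∑' n, (if n < 2 * h then P n else 0) = ∑ n ∈ Finset.range (2 * h), P n := by
      rw [tsum_eq_sum fun n hn => if_neg fun h' => hn (Finset.mem_range.2 h')]
      exact Finset.sum_congr rfl fun n hn => if_pos (Finset.mem_range.1 hn)
    rw [← hfin, ← ENNReal.tsum_add]
    congr 1 with n
    split_ifs <;> simp
  rw [show ∑' n, P n = 1 from PMF.tsum_coe _] at hsplit
  have hhead : ∑ n ∈ Finset.range (2 * h), P n ≤ ENNReal.ofReal (Real.exp (-(m / 4))) := by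
    refine le_trans (le_of_eq ?_) (ENNReal.ofReal_le_ofReal (sum_range_poisson_le hm))
    rw [ENNReal.ofReal_sum_of_nonneg fun n _ => by positivity]
    refine Finset.sum_congr rfl fun n _ => ?_
    simp only [hP, ← ProbabilityTheory.poissonPMFReal_ofReal_eq_poissonPMF]
    rfl
  have htail : ENNReal.ofReal (1 - Real.exp (-(m / 4))) ≤
      ∑' n, (if n < 2 * h then 0 else P n) := by
    rw [ENNReal.ofReal_sub _ (Real.exp_pos _).le, ENNReal.ofReal_one, tsub_le_iff_left, hsplit]
    gcongr
  calc ENNReal.ofReal ((1 - Real.exp (-(m / 4))) * r)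
      = ENNReal.ofReal (1 - Real.exp (-(m / 4))) * ENNReal.ofReal r := ENNReal.ofReal_mul' hr
    _ ≤ (∑' n, (if n < 2 * h then 0 else P n)) * ENNReal.ofReal r := by gcongr
    _ = ∑' n, (if n < 2 * h then 0 else P n) * ENNReal.ofReal r := ENNReal.tsum_mul_right.symm
    _ ≤ ∑' n, (P n • (Measure.pi fun _ : Fin n => ν).map (Sigma.mk n)) E := by
        refine ENNReal.tsum_le_tsum fun n => ?_
        split_ifs with hn
        · simp
        · rw [Measure.smul_apply, smul_eq_mul]
          gcongr
          refine (ENNReal.ofReal_le_ofReal (hE n (not_lt.1 hn))).trans ?_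
          rw [ofReal_measureReal]
          refine Measure.le_map_apply (Measurable.aemeasurable ?_) _
          exact measurable_iff_le_map.2 (iInf_le _ n)
    _ ≤ iidPoissonSamples m ν E := Measure.le_sum_apply _ _

theorem rpow_le_mul_rpow {d n : ℕ} (hd : 1 ≤ d) (hn : 1 ≤ n) {u : ℝ} (hu0 : 0 < u)
    (hu : u ≤ 1 / 4) :
    u ^ (2 * (2000 * (d : ℝ) ^ 2 * n)) ≤
      u * (1 / (16 * (n : ℝ))) ^ 3 * ((u / 6) ^ (256 * d * n : ℝ)) ^ 4 := by
  have hn' : (1 : ℝ) ≤ n := by exact_mod_cast hn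
  have h1 : u ^ (n + 2) ≤ 1 / (16 * (n : ℝ)) := by
    have h4 : (n : ℝ) ≤ 4 ^ n := by exact_mod_cast (Nat.lt_pow_self (by norm_num)).le
    calc u ^ (n + 2) ≤ (1 / 4) ^ (n + 2) := pow_le_pow_left₀ hu0.le hu _
      _ = 1 / (16 * 4 ^ n) := by rw [pow_add, one_div_pow]; ring
      _ ≤ _ := by gcongr
  have h2 : u ^ 3 ≤ u / 6 := by nlinarith [mul_pos hu0 hu0]
  have e1 : u ^ (2 * (2000 * (d : ℝ) ^ 2 * n)) = u ^ (4000 * d ^ 2 * n) := by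
    rw [← Real.rpow_natCast u]; congr 1; push_cast; ring
  have e2 : (u / 6) ^ (256 * d * n : ℝ) = (u / 6) ^ (256 * d * n) := by
    rw [← Real.rpow_natCast]; push_cast; rfl
  rw [e1, e2]
  calc u ^ (4000 * d ^ 2 * n) ≤ u ^ (1 + (n + 2) * 3 + 3 * (256 * d * n) * 4) := by
        refine pow_le_pow_of_le_one hu0.le (by linarith) ?_
        have h3 : n ≤ d * n := Nat.le_mul_of_pos_left _ hd
        have h4 : d * n ≤ d ^ 2 * n := by rw [sq, mul_assoc]; exact Nat.le_mul_of_pos_left _ hd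
        nlinarith
    _ = u * (u ^ (n + 2)) ^ 3 * ((u ^ 3) ^ (256 * d * n)) ^ 4 := by ring
    _ ≤ _ := by gcongr

/-- Boxes spanned by pairs of samples from distinct disjoint rectangles form a disjoint family
of grid-aligned rectangles. -/
theorem exists_disjoint_gridAligned {d n k : ℕ} {α ι : Type*} [Fintype ι]
    {p q : Measure (Fin d → ℝ)} [IsFiniteMeasure p] [IsFiniteMeasure q] {T : ι → Set (Fin d → ℝ)}
    (hcard : Fintype.card ι ≤ 3 * k) (hrect : ∀ i, IsAxisAlignedRectangle (T i))
    (hdisj : Pairwise fun i j => Disjoint (T i) (T j))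
    (hmass : ∀ i, p.real (T i) + q.real (T i) ≤ 1 / k) {β : ℝ} (hβ : 0 ≤ β)
    (x : Fin n → Fin d → ℝ) (a b : α → Fin n) (s : Finset α) (j : α → ι) (hj : Set.InjOn j s)
    (ha : ∀ e ∈ s, x (a e) ∈ T (j e)) (hb : ∀ e ∈ s, x (b e) ∈ T (j e))
    (hbox : ∀ e ∈ s, β ≤
      |p.real (spannedBox (x (a e)) (x (b e))) - q.real (spannedBox (x (a e)) (x (b e)))|) :
    ∃ k' : ℕ, k' ≤ 3 * k ∧ ∃ R : Fin k' → Set (Fin d → ℝ), (∀ i, GridAligned x (R i)) ∧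
      (Pairwise fun i j => Disjoint (R i) (R j)) ∧
      (∀ i, (p (R i)).toReal + (q (R i)).toReal ≤ 1 / k) ∧
      s.card * β ^ 2 ≤ ∑ i, ((p (R i)).toReal - (q (R i)).toReal) ^ 2 := by
  classical
  have hsub : ∀ e ∈ s, spannedBox (x (a e)) (x (b e)) ⊆ T (j e) := fun e he =>
    (hrect _).spannedBox_subset (ha e he) (hb e he)
  let v : Fin s.card → s := s.equivFin.symm
  refine ⟨s.card, ?_, fun i => spannedBox (x (a (v i))) (x (b (v i))), fun i => ?_, ?_,
    fun i => ?_, ?_⟩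
  · refine le_trans ?_ hcard
    rw [← Finset.card_image_of_injOn hj]
    exact Finset.card_le_univ _
  · exact ⟨fun _ => a (v i), fun _ => b (v i), rfl⟩
  · intro i i' hne
    refine (hdisj ?_).mono (hsub _ (v i).2) (hsub _ (v i').2)
    exact fun h => hne (s.equivFin.symm.injective (Subtype.ext (hj (v i).2 (v i').2 h)))
  · exact (add_le_add (measureReal_mono (hsub _ (v i).2))
      (measureReal_mono (hsub _ (v i).2))).trans (hmass _)
  · have := Finset.card_nsmul_le_sum (Finset.univ : Finset (Fin s.card))
      (fun i => ((p (spannedBox (x (a (v i))) (x (b (v i))))).toReal -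
        (q (spannedBox (x (a (v i))) (x (b (v i))))).toReal) ^ 2) (β ^ 2) fun i _ => by
          rw [← sq_abs (_ - _)]
          exact pow_le_pow_left₀ hβ (hbox _ (v i).2) 2
    simpa using this

theorem isProbabilityMeasure_half_smul_add {X : Type*} [MeasurableSpace X] (p q : Measure X)
    [IsProbabilityMeasure p] [IsProbabilityMeasure q] :
    IsProbabilityMeasure ((2 : ℝ≥0∞)⁻¹ • (p + q)) :=
  ⟨by rw [Measure.smul_apply, Measure.add_apply, measure_univ, measure_univ, smul_eq_mul,
    one_add_one_eq_two, ENNReal.inv_mul_cancel two_ne_zero ENNReal.ofNat_ne_top]⟩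

/-- If sufficiently many samples are drawn, then with high probability a fixed fraction of the
pairs of samples spans disjoint grid-aligned rectangles of large discrepancy. -/
theorem le_prob_exists_gridAligned {d k h n : ℕ} (hk : 0 < k) (l : Fin d)
    (p q : Measure (Fin d → ℝ)) [IsProbabilityMeasure p] [IsProbabilityMeasure q]
    (hp : ∀ t, p {x | x l = t} = 0) (hq : ∀ t, q {x | x l = t} = 0) {ε δ : ℝ} (hε : 0 < ε)
    (hA : ε ≤ AkDist k p q) (hδ0 : 0 < δ) (hδ : δ ≤ 1 / (16 * (2 : ℝ) ^ 2 ^ (d + 1)))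
    (h0 : 0 < h) (hhk : h ≤ k) (hn : 2 * h ≤ n) {τ : ℝ} (hτ : τ = (ε / 24) ^ (16 * d / δ)) :
    1 - (8 / (h ^ 2 * (ε * δ * τ ^ 2 / (16 * k))) + 4 * h / k) ≤
      (Measure.pi fun _ : Fin n => (2 : ℝ≥0∞)⁻¹ • (p + q)).real
        {x | ∃ k' : ℕ, k' ≤ 3 * k ∧ ∃ R : Fin k' → Set (Fin d → ℝ),
          (∀ i, GridAligned x (R i)) ∧ (Pairwise fun i j => Disjoint (R i) (R j)) ∧
          (∀ i, (p (R i)).toReal + (q (R i)).toReal ≤ 1 / k) ∧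
          h ^ 2 * (ε * δ * τ ^ 2 / (16 * k)) / 4 * (δ / 4 * (τ / k)) ^ 2 ≤
            ∑ i, ((p (R i)).toReal - (q (R i)).toReal) ^ 2} := by
  have hk' : (0 : ℝ) < k := by exact_mod_cast hk
  have h0' : (0 : ℝ) < h := by exact_mod_cast h0
  have hτ0 : 0 < τ := by rw [hτ]; positivity
  have hδ1 : δ ≤ 1 / 2 := by
    refine hδ.trans (one_div_le_one_div_of_le two_pos ?_)
    have : (1 : ℝ) ≤ 2 ^ 2 ^ (d + 1) := one_le_pow₀ one_le_two
    linarith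
  obtain ⟨ι, _, T, hcard, hcard', hrect, hdisj, hmass, hdisc, hbox⟩ :=
    exists_many_rectangles hk l p q hp hq hε hA hδ0 hδ1
  rw [← hτ] at hdisc hbox
  set μ : Measure (Fin d → ℝ) := (2 : ℝ≥0∞)⁻¹ • (p + q) with hμ
  have hμr : ∀ S, μ.real S = (p.real S + q.real S) / 2 := by
    intro S
    rw [hμ, measureReal_ennreal_smul_apply, measureReal_add_apply, ENNReal.toReal_inv,
      ENNReal.toReal_ofNat, inv_mul_eq_div]
  have : IsProbabilityMeasure μ := isProbabilityMeasure_half_smul_add p q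
  let G : ι → Set ((Fin d → ℝ) × (Fin d → ℝ)) := fun i =>
    {w | w.1 ∈ T i ∧ w.2 ∈ T i ∧ δ * μ.real (T i) ≤ μ.real (spannedBox w.1 w.2)}
  have hT : ∀ i, MeasurableSet (T i) := fun i => (hrect i).measurableSet
  have hG : ∀ i, MeasurableSet (G i) := fun i =>
    (measurable_fst (hT i)).inter ((measurable_snd (hT i)).inter
      (measurableSet_le measurable_const (measurable_measureReal_spannedBox μ)))
  set g : ℝ := ∑ i, (μ.prod μ).real (G i) with hg
  have hgle : ε * δ * τ ^ 2 / (16 * k) ≤ g := by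
    have h1 : ∀ i, δ * (τ / (2 * k)) ^ 2 ≤ (μ.prod μ).real (G i) := by
      intro i
      refine le_trans ?_ (le_measure_good_pairs μ (hT i) hδ0.le hδ)
      have h2 : τ / (2 * k) ≤ μ.real (T i) := by
        have := (hdisc i).trans (abs_measureReal_sub_le p q (T i))
        have h3 : τ / (2 * k) = τ / k / 2 := by rw [div_div, mul_comm]
        rw [hμr, h3]
        linarith
      gcongr
    have h4 := Finset.card_nsmul_le_sum (Finset.univ : Finset ι) _ _ fun i _ => h1 i
    rw [Finset.card_univ, nsmul_eq_mul] at h4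
    refine le_trans (le_trans (le_of_eq ?_)
      (mul_le_mul_of_nonneg_right hcard' (by positivity : 0 ≤ δ * (τ / (2 * k)) ^ 2))) h4
    field_simp; norm_num
  have hb0 : 0 < ε * δ * τ ^ 2 / (16 * k) := by positivity
  have hg0 : 0 < g := hb0.trans_le hgle
  let w : Fin h ⊕ Fin h → Fin n := fun c => Fin.castLE (by omega) (finSumFinEquiv c)
  have hw : Function.Injective w :=
    (Fin.castLE_injective _).comp finSumFinEquiv.injective
  have key := le_prob_many_good_pairs μ hT hG hdisj (fun i z hz => ⟨hz.1, hz.2.1⟩) hk'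
    (fun i => by
      rw [hμr, div_le_div_iff₀ two_pos (by positivity)]
      have := hmass i
      rw [le_div_iff₀ hk'] at this
      linarith) hg.symm hg0 h0 (by exact_mod_cast hhk) hw
  refine le_trans ?_ (key.trans (measureReal_mono ?_))
  · gcongr
  · rintro x ⟨s, j, hj, hs, hle⟩
    obtain ⟨k', hk3, R, h1, h2, h3, h4⟩ := exists_disjoint_gridAligned hcard hrect hdisj hmass
      (by positivity : 0 ≤ δ / 4 * (τ / k)) x (fun e : Fin h × Fin h => w (.inl e.1))
      (fun e => w (.inr e.2)) s j hj
      (fun e he => (hs e he).1) (fun e he => (hs e he).2.1) fun e he => by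
        refine hbox (j e) _ (hs e he).1 _ (hs e he).2.1 ?_
        have := (hs e he).2.2
        simp only [hμr] at this
        linarith
    refine ⟨k', hk3, R, h1, h2, h3, le_trans ?_ h4⟩
    refine mul_le_mul_of_nonneg_right (le_trans ?_ hle) (by positivity)
    gcongr

/-- **Lemma 2.3: existence of a small set of witnessing grid-aligned rectangles.**
There are universal constants `C₀, C, A, c` (with `α_d = C₀·d²·2^(2^(d+1))`) such that:
if `p, q` are probability distributions on `ℝ^d` with continuous coordinate-marginal CDFs
and `‖p − q‖_{A_k} ≥ ε`, and `S` is a tuple of `Poisson(m)` i.i.d. samples from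
`(1/2)(p+q)` with `k > m ≥ C·√k/(ε/4)^(2α_d)`, then with probability at least `9/10`
there exist `k' ≤ 3k` pairwise disjoint grid-aligned rectangles `R̃᷈_1, …, R̃_{k'}` with
`p(R̃_i) + q(R̃_i) ≤ A/k` for all `i` and
`Σ_i (p(R̃_i) − q(R̃_i))² ≥ c·(ε/4)^(2α_d)·m²/k³`. -/
theorem witnessing_grid_rectangles :
    ∃ C₀ C A c : ℝ, 1 ≤ C₀ ∧ 1 ≤ C ∧ 0 < A ∧ 0 < c ∧
      ∀ (d k m : ℕ), 1 ≤ d → 2 ≤ k → m < k →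
      ∀ ε : ℝ, 0 < ε → ε < 1 →
      C * Real.sqrt k / (ε / 4) ^ (2 * (C₀ * (d : ℝ) ^ 2 * (2 : ℝ) ^ (2 ^ (d + 1)))) ≤ m →
      ∀ p q : Measure (Fin d → ℝ),
        IsProbabilityMeasure p → IsProbabilityMeasure q →
        (∀ i : Fin d, Continuous fun t : ℝ => (p {x | x i ≤ t}).toReal) →
        (∀ i : Fin d, Continuous fun t : ℝ => (q {x | x i ≤ t}).toReal) →
        ε ≤ AkDist k p q →
        (9 : ℝ≥0∞) / 10 ≤
          iidPoissonSamples m ((2 : ℝ≥0∞)⁻¹ • (p + q))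
            {S : Σ n : ℕ, Fin n → Fin d → ℝ |
              ∃ k' : ℕ, k' ≤ 3 * k ∧
              ∃ R : Fin k' → Set (Fin d → ℝ),
                (∀ i, GridAligned S.2 (R i)) ∧
                (Pairwise fun i j => Disjoint (R i) (R j)) ∧
                (∀ i, (p (R i)).toReal + (q (R i)).toReal ≤ A / k) ∧
                c * (ε / 4) ^ (2 * (C₀ * (d : ℝ) ^ 2 * (2 : ℝ) ^ (2 ^ (d + 1)))) *
                    (m : ℝ) ^ 2 / (k : ℝ) ^ 3 ≤
                  ∑ i, ((p (R i)).toReal - (q (R i)).toReal) ^ 2} := by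
  refine ⟨2000, 100000, 1, 1 / 655360000, by norm_num, by norm_num, one_pos, by norm_num, ?_⟩
  intro d k m hd hk hmk ε hε0 hε1 hm p q _ _ hpc hqc hA
  have hk0 : (0 : ℝ) < k := by exact_mod_cast (by omega : 0 < k)
  have hk1 : (1 : ℝ) ≤ k := by exact_mod_cast (by omega : 1 ≤ k)
  have hmk' : (m : ℝ) < k := by exact_mod_cast hmk
  have hD : (2 : ℝ) ^ (2 ^ (d + 1)) = ((2 ^ 2 ^ (d + 1) : ℕ) : ℝ) := by push_cast; rfl
  have hD1 : 1 ≤ 2 ^ 2 ^ (d + 1) := Nat.one_le_two_pow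
  have hexp := rpow_le_mul_rpow (u := ε / 4) hd hD1 (by positivity) (by linarith)
  rw [← hD] at hexp
  set D : ℝ := (2 : ℝ) ^ (2 ^ (d + 1)) with hDdef
  have hD0 : 0 < D := by positivity
  have hD1' : 1 ≤ D := one_le_pow₀ one_le_two
  set B : ℝ := (ε / 4) ^ (2 * (2000 * (d : ℝ) ^ 2 * D)) with hB
  have hB0 : 0 < B := by positivity
  have hB1 : B ≤ 1 := Real.rpow_le_one (by positivity) (by linarith) (by positivity)
  set δ : ℝ := 1 / (16 * D) with hδ
  have hδ0 : 0 < δ := by positivity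
  have hδ1 : δ ≤ 1 := by rw [hδ, div_le_one (by positivity)]; linarith
  set τ : ℝ := (ε / 24) ^ (16 * d / δ) with hτ
  have hτ0 : 0 < τ := by positivity
  have hτ1 : τ ≤ 1 := Real.rpow_le_one (by positivity) (by linarith) (by positivity)
  have hτe : τ = (ε / 4 / 6) ^ (256 * d * D : ℝ) := by
    rw [hτ, hδ]; congr 1
    · ring
    · field_simp; ring
  rw [← hτe] at hexp
  have hY : B ≤ ε * δ ^ 3 * τ ^ 4 := by
    refine hexp.trans ?_
    gcongr
    linarith
  have hX : B ≤ ε * δ * τ ^ 2 := by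
    refine hY.trans ?_
    have h1 : δ ^ 3 ≤ δ := by
      simpa using pow_le_pow_of_le_one hδ0.le hδ1 (by norm_num : 1 ≤ 3)
    have h2 : τ ^ 4 ≤ τ ^ 2 := pow_le_pow_of_le_one hτ0.le hτ1 (by norm_num)
    gcongr
  rw [div_le_iff₀ hB0] at hm
  have hsq1 : 1 ≤ Real.sqrt k := Real.one_le_sqrt.2 hk1
  have hm0 : (100000 : ℝ) ≤ m := by
    have : (m : ℝ) * B ≤ m := mul_le_of_le_one_right (Nat.cast_nonneg _) hB1
    linarith
  have hmm : 10 ^ 10 * k ≤ (m : ℝ) ^ 2 * B := by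
    have h1 : (100000 * Real.sqrt k) ^ 2 ≤ (m * B) ^ 2 :=
      pow_le_pow_left₀ (by positivity) hm 2
    rw [mul_pow, Real.sq_sqrt hk0.le, mul_pow] at h1
    have h2 : (m : ℝ) ^ 2 * B ^ 2 ≤ m ^ 2 * B :=
      mul_le_mul_of_nonneg_left (by nlinarith) (by positivity)
    linarith
  obtain ⟨h, hh⟩ : ∃ h, h = m / 400 := ⟨_, rfl⟩
  have hh1 : 400 * h ≤ m := by omega
  have hh2 : m ≤ 800 * h := by
    have : 100000 ≤ m := by exact_mod_cast hm0
    omega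
  have hh1' : 400 * (h : ℝ) ≤ m := by exact_mod_cast hh1
  have hh2' : (m : ℝ) ≤ 800 * h := by exact_mod_cast hh2
  have hh0 : (0 : ℝ) < h := by linarith
  have hhsq : (m : ℝ) ^ 2 ≤ 640000 * h ^ 2 := by nlinarith
  set r : ℝ := 1 - (8 / (h ^ 2 * (ε * δ * τ ^ 2 / (16 * k))) + 4 * h / k) with hr
  have hr97 : 97 / 100 ≤ r := by
    have h1 : 4 * h / (k : ℝ) ≤ 1 / 100 := by
      rw [div_le_div_iff₀ hk0 (by norm_num)]; linarith
    have h2 : 400 ≤ (h : ℝ) ^ 2 * (ε * δ * τ ^ 2 / (16 * k)) := by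
      rw [← mul_div_assoc, le_div_iff₀ (by positivity)]
      have : (m : ℝ) ^ 2 * B ≤ 640000 * h ^ 2 * (ε * δ * τ ^ 2) := by gcongr
      linarith
    have h3 : 8 / ((h : ℝ) ^ 2 * (ε * δ * τ ^ 2 / (16 * k))) ≤ 8 / 400 := by gcongr
    linarith
  have hexpm : Real.exp (-(m / 4)) ≤ 1 / 100 := by
    rw [Real.exp_neg, ← one_div]
    refine one_div_le_one_div_of_le (by norm_num) ?_
    linarith [Real.add_one_le_exp ((m : ℝ) / 4)]
  have : IsProbabilityMeasure ((2 : ℝ≥0∞)⁻¹ • (p + q)) := isProbabilityMeasure_half_smul_add p q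
  have h910 : (9 : ℝ≥0∞) / 10 = ENNReal.ofReal (9 / 10) := by
    rw [ENNReal.ofReal_div_of_pos (by norm_num)]; norm_num
  rw [h910]
  refine le_trans (ENNReal.ofReal_le_ofReal (?_ : _ ≤ (1 - Real.exp (-(m / 4))) * r))
    (le_iidPoissonSamples _ (h := h) (by omega) _ (by linarith) fun n hn => ?_)
  · nlinarith
  let l : Fin d := ⟨0, hd⟩
  refine (le_prob_exists_gridAligned (h := h) (by omega) l p q
    (measure_singleton_eq_zero_of_continuous p (hpc l))
    (measure_singleton_eq_zero_of_continuous q (hqc l)) hε0 hA hδ0 le_rfl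
    (by exact_mod_cast hh0) (by omega) hn hτ).trans (measureReal_mono ?_)
  rintro x ⟨k', hk3, R, h1, h2, h3, h4⟩
  refine ⟨k', hk3, R, h1, h2, h3, le_trans ?_ h4⟩
  calc 1 / 655360000 * B * (m : ℝ) ^ 2 / (k : ℝ) ^ 3
      ≤ 1 / 655360000 * (ε * δ ^ 3 * τ ^ 4) * (640000 * h ^ 2) / (k : ℝ) ^ 3 := by gcongr
    _ = _ := by field_simp; norm_num
end

section
/- There is a universal constant C such that the following holds. Fix integers n ≥ 1 and s ∈ [n] and ε ∈ (0,1), and set m = ⌈C·max(ε^(−4/3), ε^(−2)/√s)⌉. There exists a (possibly randomized) test T that draws N_p ∼ Poisson(m) i.i.d. samples from a distribution p on [n] and independently N_q ∼ Poisson(m) i.i.d. samples from a distribution q on [n], and with probability at least 9/10 distinguishes the following two cases for every pair p, q: (a) p = q, in which case T accepts; versus (b) there exists a set H ⊆ [n] of size s such that Σ_{i∈H} (p_i − q_i)² ≥ ε² and max_{i∈H} (p_i + q_i)/2 ≤ 1/s, in which case T rejects. -/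
open MeasureTheory
open scoped NNReal ENNReal

/-- The number of samples `m = ⌈C·max(ε^(−4/3), ε^(−2)/√s)⌉`. -/
noncomputable def flattenSampleCount (C : ℝ) (s : ℕ) (ε : ℝ) : ℕ :=
  ⌈C * max (ε ^ (-(4 : ℝ) / 3)) (ε ^ (-(2 : ℝ)) / Real.sqrt s)⌉₊

open ProbabilityTheory

/-- The histogram of a finite tuple of samples. -/
def sampleCounts {X : Type*} [DecidableEq X] (x : Σ n : ℕ, Fin n → X) (i : X) : ℕ :=
  ∑ j, if x.2 j = i then 1 else 0

lemma measurable_sigma_mk {ι : Type*} {β : ι → Type*} [∀ i, MeasurableSpace (β i)] (i : ι) :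
    Measurable (Sigma.mk i : β i → Sigma β) :=
  fun _ hs => (MeasurableSpace.measurableSet_iInf.1 hs) i

lemma measurable_sigma_of_discrete {ι : Type*} {β : ι → Type*} {γ : Type*}
    [∀ i, MeasurableSpace (β i)] [∀ i, DiscreteMeasurableSpace (β i)] [MeasurableSpace γ]
    (f : Sigma β → γ) : Measurable f :=
  fun s _ => MeasurableSpace.measurableSet_iInf.2 fun i =>
    MeasurableSet.of_discrete (s := (f ∘ Sigma.mk i) ⁻¹' s)

set_option linter.deprecated false in
lemma poissonPMF_toReal (m : ℝ≥0) (n : ℕ) :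
    (poissonPMF m n).toReal = Real.exp (-m) * m ^ n / n.factorial := by
  rw [← poissonPMFReal_ofReal_eq_poissonPMF, ENNReal.toReal_ofReal poissonPMFReal_nonneg,
    poissonPMFReal]

instance isProbabilityMeasure_iidPoissonSamples {X : Type*} [MeasurableSpace X] (m : ℝ≥0)
    (ν : Measure X) [IsProbabilityMeasure ν] :
    IsProbabilityMeasure (iidPoissonSamples m ν) := by
  constructor
  rw [iidPoissonSamples, Measure.sum_apply _ MeasurableSet.univ]
  simp [Measure.map_apply (measurable_sigma_mk _), PMF.tsum_coe]

lemma hasSum_integral_iidPoissonSamples {X E : Type*} [MeasurableSpace X] [NormedAddCommGroup E]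
    [NormedSpace ℝ E] (m : ℝ≥0) (ν : Measure X) [IsProbabilityMeasure ν]
    {f : (Σ n : ℕ, Fin n → X) → E} (hfm : StronglyMeasurable f)
    (hf : Integrable f (iidPoissonSamples m ν)) :
    HasSum (fun n => (Real.exp (-m) * m ^ n / n.factorial) •
      ∫ x : Fin n → X, f ⟨n, x⟩ ∂(Measure.pi fun _ => ν)) (∫ x, f x ∂(iidPoissonSamples m ν)) := by
  have h := hasSum_integral_measure hf
  convert! h using 2 with n
  rw [integral_smul_measure, poissonPMF_toReal, integral_map (measurable_sigma_mk n).aemeasurable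
    hfm.aestronglyMeasurable]

/-- The Laplace functional of a Poissonized i.i.d. sample, at an imaginary argument. -/
lemma integral_exp_iidPoissonSamples {X : Type*} [MeasurableSpace X] (m : ℝ≥0) (ν : Measure X)
    [IsProbabilityMeasure ν] (t : X → ℝ)
    (ht : Measurable fun x : Σ n : ℕ, Fin n → X => ∑ j, t (x.2 j)) :
    ∫ x, Complex.exp (((∑ j, t (x.2 j) : ℝ) : ℂ) * Complex.I) ∂(iidPoissonSamples m ν) =
      Complex.exp (m * (∫ a, Complex.exp (t a * Complex.I) ∂ν - 1)) := by
  have hm : Measurable fun x : Σ n : ℕ, Fin n → X =>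
      Complex.exp (((∑ j, t (x.2 j) : ℝ) : ℂ) * Complex.I) := by fun_prop
  have hint : Integrable (fun x : Σ n : ℕ, Fin n → X =>
      Complex.exp (((∑ j, t (x.2 j) : ℝ) : ℂ) * Complex.I)) (iidPoissonSamples m ν) :=
    Integrable.of_bound hm.aestronglyMeasurable 1
      (Filter.Eventually.of_forall fun x => (Complex.norm_exp_ofReal_mul_I _).le)
  refine (hasSum_integral_iidPoissonSamples m ν hm.stronglyMeasurable hint).unique ?_
  set φ := ∫ a, Complex.exp (t a * Complex.I) ∂ν with hφ
  have hpow : ∀ n : ℕ, ∫ x : Fin n → X,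
      Complex.exp (((∑ j, t (x j) : ℝ) : ℂ) * Complex.I) ∂(Measure.pi fun _ => ν) = φ ^ n := by
    intro n
    simp only [Complex.ofReal_sum, Finset.sum_mul, Complex.exp_sum]
    rw [integral_fintype_prod_eq_prod (f := fun _ a => Complex.exp (t a * Complex.I))]
    simp [hφ]
  simp only [hpow]
  convert! (NormedSpace.expSeries_div_hasSum_exp (m * φ : ℂ)).mul_left (Complex.exp (-m)) using 1
  · ext n
    rw [Complex.real_smul]
    push_cast
    ring
  · rw [← Complex.exp_eq_exp_ℂ, ← Complex.exp_add]
    ring_nf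

/-- Poissonization: the counts of a `Poisson(m)` number of i.i.d. samples from `ν` are independent
Poisson variables with means `m * ν {i}`. -/
lemma map_sampleCounts_iidPoissonSamples {n : ℕ} (m : ℝ≥0) (ν : Measure (Fin n))
    [IsProbabilityMeasure ν] :
    (iidPoissonSamples m ν).map sampleCounts =
      Measure.pi fun i => poissonMeasure (m * (ν {i}).toNNReal) := by
  have hinj : MeasurableEmbedding (fun (c : Fin n → ℕ) i => (c i : ℝ)) := by
    refine ⟨fun a b h => ?_, by fun_prop, fun {s} _ => (s.to_countable.image _).measurableSet⟩
    ext i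
    exact_mod_cast congrFun h i
  apply hinj.map_injective
  have hc : Measurable (sampleCounts : (Σ k : ℕ, Fin k → Fin n) → Fin n → ℕ) :=
    measurable_sigma_of_discrete _
  rw [Measure.map_map hinj.measurable hc,
    Measure.pi_map_pi (μ := fun i => poissonMeasure (m * (ν {i}).toNNReal))
    (f := fun _ (k : ℕ) => (k : ℝ)) (fun i => Measurable.of_discrete.aemeasurable)]
  have : IsProbabilityMeasure ((iidPoissonSamples m ν).map
    ((fun (c : Fin n → ℕ) i => (c i : ℝ)) ∘ sampleCounts)) :=
    Measure.isProbabilityMeasure_map (hinj.measurable.comp hc).aemeasurable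
  rw [← charFun_eq_pi_iff]
  intro t
  simp_rw [charFun_map_cast_poissonMeasure]
  rw [Measure.map_map (by fun_prop) (hinj.measurable.comp hc), charFun_apply,
    integral_map (by exact (Measurable.comp (by fun_prop) (hinj.measurable.comp hc)).aemeasurable)
      (by fun_prop)]
  have key := integral_exp_iidPoissonSamples m ν (fun a => t a) (measurable_sigma_of_discrete _)
  have hν : ∑ i, ((ν {i}).toNNReal : ℂ) = 1 := by
    have h1 : ∑ i, ν {i} = 1 := by
      rw [sum_measure_singleton, Finset.coe_univ, measure_univ]
    have h2 : ∑ i, (ν {i}).toNNReal = 1 := by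
      rw [← ENNReal.toNNReal_sum (fun i _ => measure_ne_top ν _), h1, ENNReal.toNNReal_one]
    exact_mod_cast congrArg (fun x : ℝ≥0 => (x : ℂ)) h2
  convert! key using 1
  · refine integral_congr_ae (Filter.Eventually.of_forall fun x => ?_)
    have : ∀ i, ((sampleCounts x i : ℕ) : ℝ) = ∑ j, if x.2 j = i then (1 : ℝ) else 0 := by
      intro i
      simp [sampleCounts]
    simp only [Function.comp_apply, PiLp.inner_apply, this]
    simp only [Real.inner_apply, Finset.sum_mul]
    rw [Finset.sum_comm]
    simp
  · rw [← Complex.exp_sum, integral_fintype (Integrable.of_finite)]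
    congr 1
    simp only [Measure.real, Complex.real_smul]
    have hmν : (m : ℂ) = ∑ i, (m : ℂ) * ((ν {i}).toNNReal : ℂ) := by
      rw [← Finset.mul_sum, hν, mul_one]
    rw [mul_sub, mul_one, Finset.mul_sum]
    conv_rhs => arg 2; rw [hmν]
    rw [← Finset.sum_sub_distrib]
    refine Finset.sum_congr rfl fun i _ => ?_
    have : ((ν {i}).toReal : ℂ) = ((ν {i}).toNNReal : ℂ) := rfl
    rw [this]
    push_cast
    ring

/-- `F` is integrable against `μ`, with integral `v`. -/
def HasIntegral {Ω : Type*} [MeasurableSpace Ω] (μ : Measure Ω) (F : Ω → ℝ) (v : ℝ) : Prop :=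
  Integrable F μ ∧ ∫ ω, F ω ∂μ = v

namespace HasIntegral

variable {Ω : Type*} [MeasurableSpace Ω] {μ : Measure Ω} {F G : Ω → ℝ} {v w : ℝ}

lemma add (hF : HasIntegral μ F v) (hG : HasIntegral μ G w) :
    HasIntegral μ (fun ω => F ω + G ω) (v + w) :=
  ⟨hF.1.add hG.1, by rw [integral_add hF.1 hG.1, hF.2, hG.2]⟩

lemma sub (hF : HasIntegral μ F v) (hG : HasIntegral μ G w) :
    HasIntegral μ (fun ω => F ω - G ω) (v - w) :=
  ⟨hF.1.sub hG.1, by rw [integral_sub hF.1 hG.1, hF.2, hG.2]⟩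

lemma const_mul (c : ℝ) (hF : HasIntegral μ F v) : HasIntegral μ (fun ω => c * F ω) (c * v) :=
  ⟨hF.1.const_mul c, by rw [integral_const_mul, hF.2]⟩

lemma congr (hF : HasIntegral μ F v) (h : ∀ ω, G ω = F ω) (hv : w = v) : HasIntegral μ G w := by
  rwa [funext h, hv]

lemma mono (hF : HasIntegral μ F v) (hG : HasIntegral μ G w) (h : ∀ ω, F ω ≤ G ω) : v ≤ w := by
  rw [← hF.2, ← hG.2]
  exact integral_mono hF.1 hG.1 h

lemma const [IsProbabilityMeasure μ] (c : ℝ) : HasIntegral μ (fun _ => c) c :=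
  ⟨integrable_const c, by simp⟩

end HasIntegral

lemma poissonMeasure_withDensity_cast (a : ℝ≥0) :
    (poissonMeasure a).withDensity (fun n => ((n : ℝ≥0) : ℝ≥0∞)) =
      a • (poissonMeasure a).map (· + 1) := by
  refine Measure.ext_of_singleton fun n => ?_
  rw [withDensity_apply _ (measurableSet_singleton n), lintegral_singleton, Measure.smul_apply,
    Measure.map_apply (by fun_prop) (measurableSet_singleton n)]
  cases n with
  | zero =>
    have : (fun k : ℕ => k + 1) ⁻¹' {0} = ∅ := by ext; simp
    simp [this]
  | succ n =>
    have : (fun k : ℕ => k + 1) ⁻¹' {n + 1} = {n} := by ext; simp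
    rw [this, poissonMeasure_singleton, poissonMeasure_singleton, ENNReal.smul_def, smul_eq_mul,
      ← ENNReal.ofReal_coe_nnreal, ← ENNReal.ofReal_coe_nnreal,
      ← ENNReal.ofReal_mul (by positivity), ← ENNReal.ofReal_mul (by positivity)]
    congr 1
    rw [Nat.factorial_succ]
    push_cast
    field_simp
    ring

/-- If tilting `μ` by `k` amounts to shifting by `S`, integrals of `k * F` are integrals of
`F ∘ S`. -/
lemma HasIntegral.of_withDensity_eq {Ω : Type*} [MeasurableSpace Ω] {μ : Measure Ω}
    {k : Ω → ℝ≥0} (hk : Measurable k) {S : Ω → Ω} (hS : Measurable S) {a : ℝ≥0}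
    (h : μ.withDensity (fun ω => (k ω : ℝ≥0∞)) = a • μ.map S) {F : Ω → ℝ} (hF : Measurable F)
    {v : ℝ} (hv : HasIntegral μ (fun ω => F (S ω)) v) :
    HasIntegral μ (fun ω => k ω * F ω) (a * v) := by
  have h1 : Integrable F (μ.withDensity fun ω => (k ω : ℝ≥0∞)) := by
    rw [h]
    exact ((integrable_map_measure hF.aestronglyMeasurable
      hS.aemeasurable).2 hv.1).smul_measure_nnreal
  refine ⟨(integrable_withDensity_iff_integrable_coe_smul hk).1 h1, ?_⟩
  have h2 := integral_withDensity_eq_integral_smul hk (μ := μ) F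
  rw [h, integral_smul_nnreal_measure, integral_map hS.aemeasurable hF.aestronglyMeasurable,
    hv.2] at h2
  exact h2.symm

section PoissonPair

variable {a b : ℝ≥0} {v : ℝ}

lemma HasIntegral.fst_mul {F : ℕ → ℕ → ℝ}
    (h : HasIntegral ((poissonMeasure a).prod (poissonMeasure b)) (fun z => F (z.1 + 1) z.2) v) :
    HasIntegral ((poissonMeasure a).prod (poissonMeasure b)) (fun z => z.1 * F z.1 z.2)
      (a * v) := by
  refine HasIntegral.of_withDensity_eq (k := fun z : ℕ × ℕ => (z.1 : ℝ≥0))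
    (S := Prod.map (· + 1) id) (F := fun z => F z.1 z.2) Measurable.of_discrete
    Measurable.of_discrete ?_ Measurable.of_discrete h
  rw [← Measure.map_prod_map _ _ (by fun_prop) (by fun_prop), Measure.map_id,
    ← Measure.prod_smul_left, ← poissonMeasure_withDensity_cast,
    prod_withDensity_left (by fun_prop)]

lemma HasIntegral.snd_mul {F : ℕ → ℕ → ℝ}
    (h : HasIntegral ((poissonMeasure a).prod (poissonMeasure b)) (fun z => F z.1 (z.2 + 1)) v) :
    HasIntegral ((poissonMeasure a).prod (poissonMeasure b)) (fun z => z.2 * F z.1 z.2)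
      (b * v) := by
  refine HasIntegral.of_withDensity_eq (k := fun z : ℕ × ℕ => (z.2 : ℝ≥0))
    (S := Prod.map id (· + 1)) (F := fun z => F z.1 z.2) Measurable.of_discrete
    Measurable.of_discrete ?_ Measurable.of_discrete h
  rw [← Measure.map_prod_map _ _ (by fun_prop) (by fun_prop), Measure.map_id,
    ← Measure.prod_smul_right, ← poissonMeasure_withDensity_cast,
    prod_withDensity_right (by fun_prop)]

/-- Integral of a bounded function of the total count, shifted by `k`. -/
noncomputable def poissonPairMean (a b : ℝ≥0) (w : ℕ → ℝ) (k : ℕ) : ℝ :=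
  ∫ z, w (z.1 + z.2 + k) ∂((poissonMeasure a).prod (poissonMeasure b))

lemma hasIntegral_poissonPairMean {w : ℕ → ℝ} {B : ℝ} (hw : ∀ n, |w n| ≤ B) (k : ℕ) :
    HasIntegral ((poissonMeasure a).prod (poissonMeasure b)) (fun z => w (z.1 + z.2 + k))
      (poissonPairMean a b w k) :=
  ⟨Integrable.of_bound Measurable.of_discrete.aestronglyMeasurable B
    (Filter.Eventually.of_forall fun _ => hw _), rfl⟩

lemma hasIntegral_descFactorial {w : ℕ → ℝ} {B : ℝ} (hw : ∀ n, |w n| ≤ B) (i j : ℕ) :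
    HasIntegral ((poissonMeasure a).prod (poissonMeasure b))
      (fun z => z.1.descFactorial i * z.2.descFactorial j * w (z.1 + z.2))
      (a ^ i * b ^ j * poissonPairMean a b w (i + j)) := by
  have key : ∀ i j k : ℕ, HasIntegral ((poissonMeasure a).prod (poissonMeasure b))
      (fun z => z.1.descFactorial i * z.2.descFactorial j * w (z.1 + z.2 + k))
      (a ^ i * b ^ j * poissonPairMean a b w (i + j + k)) := by
    intro i
    induction i with
    | zero =>
      intro j
      induction j with
      | zero =>
        intro k
        simpa using hasIntegral_poissonPairMean hw k
      | succ j ih =>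
        intro k
        refine (HasIntegral.snd_mul (F := fun x y => x.descFactorial 0 *
          (y - 1).descFactorial j * w (x + y + k))
          (v := a ^ 0 * b ^ j * poissonPairMean a b w (0 + j + (k + 1))) ?_).congr ?_ ?_
        · refine (ih (k + 1)).congr (fun z => ?_) (by simp)
          simp only [Nat.add_sub_cancel]
          congr 2; ring
        · rintro ⟨x, y⟩
          rcases y with _ | y
          · simp
          · simp only [Nat.succ_descFactorial_succ, Nat.add_sub_cancel]
            push_cast
            ring
        · rw [show 0 + (j + 1) + k = 0 + j + (k + 1) by ring]; ring
    | succ i ih =>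
      intro j k
      refine (HasIntegral.fst_mul (F := fun x y => (x - 1).descFactorial i *
          y.descFactorial j * w (x + y + k))
          (v := a ^ i * b ^ j * poissonPairMean a b w (i + j + (k + 1))) ?_).congr ?_ ?_
      · refine (ih j (k + 1)).congr (fun z => ?_) rfl
        simp only [Nat.add_sub_cancel]
        congr 2; ring
      · rintro ⟨x, y⟩
        rcases x with _ | x
        · simp
        · simp only [Nat.succ_descFactorial_succ, Nat.add_sub_cancel]
          push_cast
          ring
      · rw [show i + 1 + j + k = i + j + (k + 1) by ring]; ring
  exact key i j 0

lemma cast_descFactorial_succ (n k : ℕ) :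
    (n.descFactorial (k + 1) : ℝ) = (n - k) * n.descFactorial k := by
  rw [Nat.descFactorial_succ]
  rcases le_or_gt k n with h | h
  · push_cast [Nat.cast_sub h]
    ring
  · simp [Nat.descFactorial_of_lt h]

lemma hasIntegral_total_mul {w : ℕ → ℝ} {B : ℝ} (hw : ∀ n, |w n| ≤ B) (k : ℕ) :
    HasIntegral ((poissonMeasure a).prod (poissonMeasure b))
      (fun z => (z.1 + z.2) * w (z.1 + z.2 + k)) ((a + b) * poissonPairMean a b w (k + 1)) := by
  have hk : ∀ n, |w (n + k)| ≤ B := fun n => hw _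
  have hm : poissonPairMean a b (fun n => w (n + k)) 1 = poissonPairMean a b w (k + 1) := by
    simp only [poissonPairMean]
    congr 1 with z
    congr 1
    ring
  refine ((hasIntegral_descFactorial hk 1 0).add (hasIntegral_descFactorial hk 0 1)).congr
    (fun z => ?_) ?_
  · simp
    ring
  · simp only [add_zero, zero_add, hm]
    ring

lemma hasIntegral_total_mul_pred {w : ℕ → ℝ} {B : ℝ} (hw : ∀ n, |w n| ≤ B) :
    HasIntegral ((poissonMeasure a).prod (poissonMeasure b))
      (fun z => (z.1 + z.2) * (z.1 + z.2 - 1) * w (z.1 + z.2))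
      ((a + b) ^ 2 * poissonPairMean a b w 2) := by
  refine (((hasIntegral_descFactorial hw 2 0).add (hasIntegral_descFactorial hw 0 2)).add
    ((hasIntegral_descFactorial hw 1 1).const_mul 2)).congr (fun z => ?_) ?_
  · simp only [cast_descFactorial_succ, Nat.descFactorial_zero]
    push_cast
    ring
  · simp only [add_zero, zero_add, Nat.reduceAdd]
    ring

/-- The bias-corrected squared difference of two counts, with weight `w` of the total count. -/
def weightedTerm (w : ℕ → ℝ) (z : ℕ × ℕ) : ℝ :=
  w (z.1 + z.2) * (((z.1 : ℝ) - z.2) ^ 2 - z.1 - z.2)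

lemma hasIntegral_weightedTerm {w : ℕ → ℝ} {B : ℝ} (hw : ∀ n, |w n| ≤ B) :
    HasIntegral ((poissonMeasure a).prod (poissonMeasure b)) (weightedTerm w)
      (((a : ℝ) - b) ^ 2 * poissonPairMean a b w 2) := by
  refine (((hasIntegral_descFactorial hw 2 0).add (hasIntegral_descFactorial hw 0 2)).sub
    ((hasIntegral_descFactorial hw 1 1).const_mul 2)).congr (fun z => ?_) ?_
  · simp only [weightedTerm, cast_descFactorial_succ, Nat.descFactorial_zero]
    push_cast
    ring
  · simp only [add_zero, zero_add, Nat.reduceAdd]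
    ring

lemma hasIntegral_weightedTerm_sq {w : ℕ → ℝ} {B : ℝ} (hw : ∀ n, |w n ^ 2| ≤ B) :
    HasIntegral ((poissonMeasure a).prod (poissonMeasure b)) (fun z => weightedTerm w z ^ 2)
      (((a : ℝ) - b) ^ 4 * poissonPairMean a b (fun n => w n ^ 2) 4 +
        4 * (a + b) * ((a : ℝ) - b) ^ 2 * poissonPairMean a b (fun n => w n ^ 2) 3 +
        2 * (a + b) ^ 2 * poissonPairMean a b (fun n => w n ^ 2) 2) := by
  have H := fun i j => hasIntegral_descFactorial (a := a) (b := b) hw i j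
  have h4 := (((H 4 0).add (H 0 4)).add ((H 2 2).const_mul 6)).sub
    (((H 3 1).add (H 1 3)).const_mul 4)
  have h3 := (((H 3 0).add (H 0 3)).sub ((H 2 1).add (H 1 2))).const_mul 4
  have h2 := (((H 2 0).add (H 0 2)).add ((H 1 1).const_mul 2)).const_mul 2
  refine ((h4.add h3).add h2).congr (fun z => ?_) ?_
  · simp only [weightedTerm, cast_descFactorial_succ, Nat.descFactorial_zero]
    push_cast
    ring
  · simp only [add_zero, zero_add, Nat.reduceAdd]
    ring

section InverseWeight

variable {ρ : ℝ}

/-- The weight `n ↦ 1 / (n + ρ)`. -/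
noncomputable def inverseWeight (ρ : ℝ) (n : ℕ) : ℝ := 1 / (n + ρ)

lemma inverseWeight_nonneg (hρ : 1 ≤ ρ) (n : ℕ) : 0 ≤ inverseWeight ρ n := by
  unfold inverseWeight
  positivity

lemma inverseWeight_le_one (hρ : 1 ≤ ρ) (n : ℕ) : inverseWeight ρ n ≤ 1 := by
  unfold inverseWeight
  rw [div_le_one (by positivity)]
  linarith [Nat.cast_nonneg (α := ℝ) n]

lemma abs_inverseWeight_le_one (hρ : 1 ≤ ρ) (n : ℕ) : |inverseWeight ρ n| ≤ 1 := by
  rw [abs_of_nonneg (inverseWeight_nonneg hρ n)]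
  exact inverseWeight_le_one hρ n

lemma abs_inverseWeight_sq_le_one (hρ : 1 ≤ ρ) (n : ℕ) : |inverseWeight ρ n ^ 2| ≤ 1 := by
  rw [abs_pow]
  exact pow_le_one₀ (abs_nonneg _) (abs_inverseWeight_le_one hρ n)

/-- The Jensen inequality for the mean of the inverse weight. -/
lemma one_div_le_poissonPairMean_inverseWeight (hρ : 1 ≤ ρ) :
    1 / (a + b + (ρ + 2)) ≤ poissonPairMean a b (inverseWeight ρ) 2 := by
  have hc : 0 < (a + b + (ρ + 2) : ℝ) := by positivity
  set c : ℝ := 1 / (a + b + (ρ + 2)) with hcdef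
  have h1 := hasIntegral_poissonPairMean (a := a) (b := b) (abs_inverseWeight_le_one hρ) 2
  have hN := hasIntegral_total_mul (a := a) (b := b) (w := fun _ => 1) (B := 1) (by simp) 0
  have h2 := (HasIntegral.const (μ := (poissonMeasure a).prod (poissonMeasure b))
    (2 * c - c ^ 2 * (ρ + 2))).sub (hN.const_mul (c ^ 2))
  have h3 := h2.mono h1 fun z => ?_
  · have h4 : poissonPairMean a b (fun _ => 1) (0 + 1) = 1 := by simp [poissonPairMean]
    rw [h4] at h3
    have h5 : c * (a + b + (ρ + 2)) = 1 := by rw [hcdef]; field_simp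
    nlinarith
  · have hx : 0 < ((z.1 : ℝ) + z.2 + (ρ + 2)) := by positivity
    have : inverseWeight ρ (z.1 + z.2 + 2) = 1 / ((z.1 : ℝ) + z.2 + (ρ + 2)) := by
      unfold inverseWeight
      push_cast
      ring
    rw [this, le_div_iff₀ hx]
    nlinarith [sq_nonneg (c * ((z.1 : ℝ) + z.2 + (ρ + 2)) - 1)]

lemma sq_mul_poissonPairMean_sq_two_le (hρ : 1 ≤ ρ) :
    ((a : ℝ) + b) ^ 2 * poissonPairMean a b (fun n => inverseWeight ρ n ^ 2) 2 ≤ (a + b) / ρ := by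
  have h := (hasIntegral_total_mul (a := a) (b := b) (abs_inverseWeight_sq_le_one hρ) 1).mono
    (HasIntegral.const (1 / ρ)) fun z => ?_
  · have hab : 0 ≤ (a + b : ℝ) := by positivity
    calc _ = ((a : ℝ) + b) *
          ((a + b) * poissonPairMean a b (fun n => inverseWeight ρ n ^ 2) 2) := by ring
      _ ≤ ((a : ℝ) + b) * (1 / ρ) := mul_le_mul_of_nonneg_left h hab
      _ = _ := by ring
  · have hx : 0 ≤ ((z.1 : ℝ) + z.2) := by positivity
    have : inverseWeight ρ (z.1 + z.2 + 1) = 1 / ((z.1 : ℝ) + z.2 + (ρ + 1)) := by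
      unfold inverseWeight
      push_cast
      ring
    rw [this, div_pow, one_pow, mul_one_div, div_le_div_iff₀ (by positivity) (by positivity)]
    nlinarith

lemma mul_poissonPairMean_sq_three_le (hρ : 1 ≤ ρ) :
    ((a : ℝ) + b) * poissonPairMean a b (fun n => inverseWeight ρ n ^ 2) 3 ≤
      poissonPairMean a b (inverseWeight ρ) 2 := by
  refine (hasIntegral_total_mul (a := a) (b := b) (abs_inverseWeight_sq_le_one hρ) 2).mono
    (hasIntegral_poissonPairMean (abs_inverseWeight_le_one hρ) 2) fun z => ?_
  have hx : 0 ≤ ((z.1 : ℝ) + z.2) := by positivity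
  have : inverseWeight ρ (z.1 + z.2 + 2) = 1 / ((z.1 : ℝ) + z.2 + (ρ + 2)) := by
    unfold inverseWeight
    push_cast
    ring
  rw [this, div_pow, one_pow, mul_one_div, div_le_div_iff₀ (by positivity) (by positivity)]
  nlinarith

lemma poissonPairMean_sq_four_le (hρ : 1 ≤ ρ) :
    poissonPairMean a b (fun n => inverseWeight ρ n ^ 2) 4 ≤
      poissonPairMean a b (fun n => inverseWeight ρ n ^ 2) 2 := by
  refine (hasIntegral_poissonPairMean (abs_inverseWeight_sq_le_one hρ) 4).mono
    (hasIntegral_poissonPairMean (abs_inverseWeight_sq_le_one hρ) 2) fun z => ?_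
  refine pow_le_pow_left₀ (inverseWeight_nonneg hρ _) ?_ 2
  unfold inverseWeight
  refine one_div_le_one_div_of_le (by positivity) ?_
  push_cast
  linarith

/-- The weight of the total count concentrates: its variance is at most twice its mean, relative
to the square of the total rate. -/
lemma sq_mul_variance_inverseWeight_le (hρ : 1 ≤ ρ) :
    ((a : ℝ) + b) ^ 2 * (poissonPairMean a b (fun n => inverseWeight ρ n ^ 2) 2 -
      poissonPairMean a b (inverseWeight ρ) 2 ^ 2) ≤
      2 * poissonPairMean a b (inverseWeight ρ) 2 := by
  have hJ := one_div_le_poissonPairMean_inverseWeight (a := a) (b := b) hρ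
  have hab : 0 ≤ (a + b : ℝ) := by positivity
  have hc : 0 < (a + b + (ρ + 2) : ℝ) := by positivity
  set c : ℝ := 1 / (a + b + (ρ + 2)) with hcdef
  have hc0 : 0 < c := by positivity
  have hc1 : c ≤ 1 := by
    rw [hcdef, div_le_one hc]
    linarith
  set v : ℕ → ℝ := fun n => (inverseWeight ρ n - c) ^ 2 with hv
  have hvB : ∀ n, |v n| ≤ 1 := fun n => by
    have h0 := inverseWeight_nonneg hρ n
    have h1 := inverseWeight_le_one hρ n
    rw [hv, abs_of_nonneg (sq_nonneg _), sq_le_one_iff_abs_le_one, abs_le]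
    constructor <;> linarith
  have hvar : poissonPairMean a b v 2 = poissonPairMean a b (fun n => inverseWeight ρ n ^ 2) 2 -
      2 * c * poissonPairMean a b (inverseWeight ρ) 2 + c ^ 2 :=
    ((((hasIntegral_poissonPairMean (abs_inverseWeight_sq_le_one hρ) 2).sub
      ((hasIntegral_poissonPairMean (abs_inverseWeight_le_one hρ) 2).const_mul (2 * c))).add
      (HasIntegral.const (c ^ 2))).congr (fun z => by simp only [hv]; ring) rfl).2
  have hone : ∀ n : ℕ, |(fun _ : ℕ => (1 : ℝ)) n| ≤ 1 := by simp
  have h1 : ∀ k, poissonPairMean a b (fun _ => 1) k = 1 := by simp [poissonPairMean]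
  have hN := hasIntegral_total_mul (a := a) (b := b) hone 0
  have hN2 := hasIntegral_total_mul_pred (a := a) (b := b) hone
  rw [h1] at hN hN2
  have hle := (hasIntegral_total_mul_pred (a := a) (b := b) hvB).mono
    (((hN2.add (hN.const_mul (1 - 2 * (a + b + 2)))).add
      (HasIntegral.const (((a : ℝ) + b + 2) ^ 2))).const_mul (c ^ 2)) fun z => ?_
  · have h5 : c * (a + b + (ρ + 2)) = 1 := by rw [hcdef]; field_simp
    have h6 : ((a : ℝ) + b) ^ 2 * poissonPairMean a b v 2 ≤ c ^ 2 * (a + b + 4) :=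
      hle.trans_eq (by ring)
    have h7 : c ^ 2 * ((a : ℝ) + b + 4) ≤ 2 * c := by
      nlinarith
    have h8 : poissonPairMean a b (fun n => inverseWeight ρ n ^ 2) 2 -
      poissonPairMean a b (inverseWeight ρ) 2 ^ 2 ≤ poissonPairMean a b v 2 := by
      rw [hvar]
      nlinarith [sq_nonneg (poissonPairMean a b (inverseWeight ρ) 2 - c)]
    have := mul_le_mul_of_nonneg_left h8 (sq_nonneg ((a : ℝ) + b))
    linarith
  · set x : ℝ := (z.1 : ℝ) + z.2 with hx
    have hx0 : 0 ≤ x := by positivity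
    have hvx : v (z.1 + z.2) = c ^ 2 * ((a + b + 2 - x) ^ 2 / (x + ρ) ^ 2) := by
      simp only [hv, inverseWeight, hcdef]
      push_cast
      rw [← hx]
      field_simp
      ring
    have hxp : x * (x - 1) * ((a + b + 2 - x) ^ 2 / (x + ρ) ^ 2) ≤ (a + b + 2 - x) ^ 2 := by
      rw [← mul_div_assoc, div_le_iff₀ (by positivity), mul_comm]
      exact mul_le_mul_of_nonneg_left (by nlinarith) (sq_nonneg _)
    rw [hvx]
    nlinarith [mul_le_mul_of_nonneg_left hxp (sq_nonneg c)]

lemma memLp_weightedTerm_inverseWeight (hρ : 1 ≤ ρ) :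
    MemLp (weightedTerm (inverseWeight ρ)) 2 ((poissonMeasure a).prod (poissonMeasure b)) :=
  (memLp_two_iff_integrable_sq Measurable.of_discrete.aestronglyMeasurable).2
    (hasIntegral_weightedTerm_sq (abs_inverseWeight_sq_le_one hρ)).1

lemma variance_weightedTerm_inverseWeight_le (hρ : 1 ≤ ρ) :
    Var[weightedTerm (inverseWeight ρ); (poissonMeasure a).prod (poissonMeasure b)] ≤
      2 * ((a + b) / ρ) +
        6 * (((a : ℝ) - b) ^ 2 * poissonPairMean a b (inverseWeight ρ) 2) := by
  rw [variance_eq_sub (memLp_weightedTerm_inverseWeight hρ)]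
  have e1 := (hasIntegral_weightedTerm_sq (a := a) (b := b) (abs_inverseWeight_sq_le_one hρ)).2
  have e2 := (hasIntegral_weightedTerm (a := a) (b := b) (abs_inverseWeight_le_one hρ)).2
  simp only [Pi.pow_apply]
  rw [e1, e2]
  have i1 := sq_mul_poissonPairMean_sq_two_le (a := a) (b := b) hρ
  have i2 := mul_poissonPairMean_sq_three_le (a := a) (b := b) hρ
  have i3 := sq_mul_variance_inverseWeight_le (a := a) (b := b) hρ
  have i4 := poissonPairMean_sq_four_le (a := a) (b := b) hρ
  have hM : 0 ≤ poissonPairMean a b (inverseWeight ρ) 2 :=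
    le_trans (by positivity) (one_div_le_poissonPairMean_inverseWeight (a := a) (b := b) hρ)
  set M := poissonPairMean a b (inverseWeight ρ) 2
  set M2 := poissonPairMean a b (fun n => inverseWeight ρ n ^ 2) 2
  set M3 := poissonPairMean a b (fun n => inverseWeight ρ n ^ 2) 3
  set M4 := poissonPairMean a b (fun n => inverseWeight ρ n ^ 2) 4
  set d : ℝ := ((a : ℝ) - b) ^ 2 with hd
  have hd0 : 0 ≤ d := sq_nonneg _
  have hdl : d ≤ ((a : ℝ) + b) ^ 2 := by
    have : 0 ≤ (a * b : ℝ) := by positivity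
    rw [hd]
    nlinarith
  have hkey : d * (M4 - M ^ 2) ≤ 2 * M := by
    rcases le_total (M4 - M ^ 2) 0 with h | h
    · exact (mul_nonpos_of_nonneg_of_nonpos hd0 h).trans (by linarith)
    · calc d * (M4 - M ^ 2) ≤ ((a : ℝ) + b) ^ 2 * (M4 - M ^ 2) :=
            mul_le_mul_of_nonneg_right hdl h
        _ ≤ ((a : ℝ) + b) ^ 2 * (M2 - M ^ 2) :=
            mul_le_mul_of_nonneg_left (by linarith) (sq_nonneg _)
        _ ≤ 2 * M := i3
  have hd4 : ((a : ℝ) - b) ^ 4 = d ^ 2 := by rw [hd]; ring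
  rw [hd4]
  have k1 := mul_le_mul_of_nonneg_left hkey hd0
  have k2 := mul_le_mul_of_nonneg_left i2 hd0
  linear_combination k1 + 4 * k2 + 2 * i1

end InverseWeight

end PoissonPair

/-- The closeness statistic of two samples: the sum over the domain of the bias-corrected squared
count differences, each weighted by `1 / (N + ρ)` where `N` is the total count of the element. -/
noncomputable def closenessStatistic {n : ℕ} (ρ : ℝ)
    (x : (Σ k : ℕ, Fin k → Fin n) × (Σ k : ℕ, Fin k → Fin n)) : ℝ :=
  ∑ i, weightedTerm (inverseWeight ρ) (sampleCounts x.1 i, sampleCounts x.2 i)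

lemma measurable_closenessStatistic {n : ℕ} (ρ : ℝ) :
    Measurable (closenessStatistic (n := n) ρ) := by
  have hcount : ∀ i : Fin n, Measurable fun x : Σ k : ℕ, Fin k → Fin n => sampleCounts x i :=
    fun i => measurable_sigma_of_discrete _
  have hweight : Measurable (weightedTerm (inverseWeight ρ)) := Measurable.of_discrete
  refine Finset.measurable_sum _ fun i _ => hweight.comp ?_
  exact ((hcount i).comp measurable_fst).prodMk ((hcount i).comp measurable_snd)

lemma measurePreserving_sampleCounts_prod {n : ℕ} (m : ℝ≥0) (p q : Measure (Fin n))
    [IsProbabilityMeasure p] [IsProbabilityMeasure q] :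
    MeasurePreserving (fun (x : (Σ k : ℕ, Fin k → Fin n) × (Σ k : ℕ, Fin k → Fin n)) i =>
        (sampleCounts x.1 i, sampleCounts x.2 i))
      ((iidPoissonSamples m p).prod (iidPoissonSamples m q))
      (Measure.pi fun i => (poissonMeasure (m * (p {i}).toNNReal)).prod
        (poissonMeasure (m * (q {i}).toNNReal))) := by
  have hmp : ∀ ν : Measure (Fin n), IsProbabilityMeasure ν →
      MeasurePreserving sampleCounts (iidPoissonSamples m ν)
        (Measure.pi fun i => poissonMeasure (m * (ν {i}).toNNReal)) := fun ν _ =>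
    ⟨measurable_sigma_of_discrete _, map_sampleCounts_iidPoissonSamples m ν⟩
  exact (measurePreserving_arrowProdEquivProdArrow ℕ ℕ (Fin n) _ _).symm.comp
    ((hmp p inferInstance).prod (hmp q inferInstance))

section Statistic

variable {n : ℕ} {ρ : ℝ} (m : ℝ≥0) (p q : Measure (Fin n))

/-- The contribution of the element `i` to the mean of the closeness statistic. -/
noncomputable def closenessMean (ρ : ℝ) (m : ℝ≥0) (p q : Measure (Fin n)) (i : Fin n) : ℝ :=
  (m * (p {i}).toReal - m * (q {i}).toReal) ^ 2 *
    poissonPairMean (m * (p {i}).toNNReal) (m * (q {i}).toNNReal) (inverseWeight ρ) 2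

lemma closenessMean_nonneg (hρ : 1 ≤ ρ) (i : Fin n) : 0 ≤ closenessMean ρ m p q i :=
  mul_nonneg (sq_nonneg _)
    (le_trans (by positivity) (one_div_le_poissonPairMean_inverseWeight hρ))

/-- A set of light elements on which `p` and `q` differ makes the mean of the statistic large. -/
lemma le_sum_closenessMean (hρ : 1 ≤ ρ) {s : ℕ} (hs : (m : ℝ) / s ≤ ρ) {ε : ℝ}
    {H : Finset (Fin n)} (hε : ε ^ 2 ≤ ∑ i ∈ H, ((p {i}).toReal - (q {i}).toReal) ^ 2)
    (hH : ∀ i ∈ H, ((p {i}).toReal + (q {i}).toReal) / 2 ≤ 1 / s) :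
    (m : ℝ) ^ 2 * ε ^ 2 / (5 * ρ) ≤ ∑ i, closenessMean ρ m p q i := by
  calc (m : ℝ) ^ 2 * ε ^ 2 / (5 * ρ)
      ≤ m ^ 2 * (∑ i ∈ H, ((p {i}).toReal - (q {i}).toReal) ^ 2) / (5 * ρ) := by gcongr
    _ = ∑ i ∈ H, (m * (p {i}).toReal - m * (q {i}).toReal) ^ 2 * (1 / (5 * ρ)) := by
        rw [Finset.mul_sum, Finset.sum_div]
        refine Finset.sum_congr rfl fun i _ => ?_
        ring
    _ ≤ ∑ i ∈ H, closenessMean ρ m p q i := by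
        refine Finset.sum_le_sum fun i hi => ?_
        refine mul_le_mul_of_nonneg_left ?_ (sq_nonneg _)
        refine le_trans ?_ (one_div_le_poissonPairMean_inverseWeight hρ)
        refine one_div_le_one_div_of_le (by positivity) ?_
        have h1 : (m : ℝ) * (((p {i}).toReal + (q {i}).toReal) / 2) ≤ ρ :=
          (mul_le_mul_of_nonneg_left (hH i hi) m.2).trans (by rwa [mul_one_div])
        have h2 : ∀ ν : Measure (Fin n), ((ν {i}).toNNReal : ℝ) = (ν {i}).toReal := fun _ => rfl
        push_cast [h2]
        linarith
    _ ≤ _ := Finset.sum_le_sum_of_subset_of_nonneg (Finset.subset_univ _)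
        fun i _ _ => closenessMean_nonneg m p q hρ i

variable [IsProbabilityMeasure p] [IsProbabilityMeasure q]

lemma memLp_closenessStatistic (hρ : 1 ≤ ρ) :
    MemLp (closenessStatistic ρ) 2
      ((iidPoissonSamples m p).prod (iidPoissonSamples m q)) := by
  have hmp := measurePreserving_sampleCounts_prod m p q
  exact MemLp.comp_measurePreserving
    (g := fun z : Fin n → ℕ × ℕ => ∑ i, weightedTerm (inverseWeight ρ) (z i))
    (memLp_finsetSum _ fun i _ => (memLp_weightedTerm_inverseWeight hρ).comp_measurePreserving
      (measurePreserving_eval _ i)) hmp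

lemma integral_closenessStatistic (hρ : 1 ≤ ρ) :
    ∫ x, closenessStatistic ρ x ∂((iidPoissonSamples m p).prod (iidPoissonSamples m q)) =
      ∑ i, closenessMean ρ m p q i := by
  have hmp := measurePreserving_sampleCounts_prod m p q
  have hterm : ∀ i, HasIntegral ((poissonMeasure (m * (p {i}).toNNReal)).prod
      (poissonMeasure (m * (q {i}).toNNReal))) (weightedTerm (inverseWeight ρ))
      (closenessMean ρ m p q i) := fun i => by
    refine (hasIntegral_weightedTerm (abs_inverseWeight_le_one hρ)).congr (fun _ => rfl) ?_
    simp [closenessMean, ENNReal.toReal]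
  have h1 := integral_map (μ := (iidPoissonSamples m p).prod (iidPoissonSamples m q))
    hmp.measurable.aemeasurable
    (f := fun z : Fin n → ℕ × ℕ => ∑ i, weightedTerm (inverseWeight ρ) (z i))
    Measurable.of_discrete.aestronglyMeasurable
  rw [hmp.map_eq] at h1
  refine h1.symm.trans ?_
  rw [integral_finsetSum]
  · refine Finset.sum_congr rfl fun i _ => ?_
    rw [← (hterm i).2]
    exact integral_comp_eval Measurable.of_discrete.aestronglyMeasurable
  · exact fun i _ => ((memLp_weightedTerm_inverseWeight hρ).comp_measurePreserving
      (measurePreserving_eval _ i)).integrable one_le_two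

lemma variance_closenessStatistic_le (hρ : 1 ≤ ρ) :
    Var[closenessStatistic ρ; (iidPoissonSamples m p).prod (iidPoissonSamples m q)] ≤
      4 * (m / ρ) + 6 * ∑ i, closenessMean ρ m p q i := by
  have hmp := measurePreserving_sampleCounts_prod m p q
  have h1 := variance_map (μ := (iidPoissonSamples m p).prod (iidPoissonSamples m q))
    (X := ∑ i, fun z : Fin n → ℕ × ℕ => weightedTerm (inverseWeight ρ) (z i))
    Measurable.of_discrete.aemeasurable hmp.measurable.aemeasurable
  have h2 : (∑ i, fun z : Fin n → ℕ × ℕ => weightedTerm (inverseWeight ρ) (z i)) ∘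
      (fun (x : (Σ k : ℕ, Fin k → Fin n) × (Σ k : ℕ, Fin k → Fin n)) i =>
        (sampleCounts x.1 i, sampleCounts x.2 i)) = closenessStatistic ρ := by
    ext x
    simp [closenessStatistic]
  rw [h2, hmp.map_eq, variance_sum_pi fun i => memLp_weightedTerm_inverseWeight hρ] at h1
  rw [← h1]
  have hsum : ∀ ν : Measure (Fin n), IsProbabilityMeasure ν → ∑ i, (ν {i}).toReal = 1 := by
    intro ν _
    rw [← ENNReal.toReal_sum fun i _ => measure_ne_top ν _, sum_measure_singleton,
      Finset.coe_univ, measure_univ, ENNReal.toReal_one]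
  calc _ ≤ ∑ i, (2 * ((m * (p {i}).toReal + m * (q {i}).toReal) / ρ) +
        6 * closenessMean ρ m p q i) := by
        refine Finset.sum_le_sum fun i _ => ?_
        refine (variance_weightedTerm_inverseWeight_le hρ).trans_eq ?_
        simp [closenessMean, ENNReal.toReal]
    _ = _ := by
        rw [Finset.sum_add_distrib, ← Finset.mul_sum, ← Finset.mul_sum, ← Finset.sum_div,
          Finset.sum_add_distrib, ← Finset.mul_sum, ← Finset.mul_sum, hsum p inferInstance,
          hsum q inferInstance]
        ring

end Statistic

section Threshold

variable {Ω : Type*} [MeasurableSpace Ω] {μ : Measure Ω} [IsProbabilityMeasure μ] {Z : Ω → ℝ}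
  {τ κ : ℝ}

lemma measureReal_le_abs_sub_integral_le (hZ : MemLp Z 2 μ) {c : ℝ} (hc : 0 < c) :
    μ.real {ω | c ≤ |Z ω - ∫ ω, Z ω ∂μ|} ≤ Var[Z; μ] / c ^ 2 :=
  ENNReal.toReal_le_of_le_ofReal (div_nonneg (variance_nonneg _ _) (sq_nonneg _))
    (meas_ge_le_variance_div_sq hZ hc)

/-- A centred statistic of small variance rarely reaches the threshold. -/
lemma measureReal_threshold_le_of_centred (hZ : MemLp Z 2 μ) (hτ : 0 < τ) (hκ : 80 * κ ≤ τ ^ 2)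
    (hmean : ∫ ω, Z ω ∂μ = 0) (hvar : Var[Z; μ] ≤ 4 * κ) : μ.real {ω | τ ≤ Z ω} ≤ 1 / 10 := by
  refine (measureReal_mono fun ω (hω : τ ≤ Z ω) => ?_).trans
    ((measureReal_le_abs_sub_integral_le hZ hτ).trans ?_)
  · simpa [hmean] using hω.trans (le_abs_self _)
  · rw [div_le_iff₀ (by positivity)]
    linarith [sq_nonneg τ]

/-- A statistic whose mean exceeds twice the threshold rarely stays below the threshold. -/
lemma measureReal_lt_threshold_le (hZ : MemLp Z 2 μ) (hτ : 240 ≤ τ) (hκ : 80 * κ ≤ τ ^ 2)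
    (hmean : 2 * τ ≤ ∫ ω, Z ω ∂μ) (hvar : Var[Z; μ] ≤ 4 * κ + 6 * ∫ ω, Z ω ∂μ) :
    μ.real {ω | Z ω < τ} ≤ 1 / 10 := by
  set D := ∫ ω, Z ω ∂μ
  refine (measureReal_mono fun ω (hω : Z ω < τ) => ?_).trans
    ((measureReal_le_abs_sub_integral_le hZ (c := D / 2) (by linarith)).trans ?_)
  · change D / 2 ≤ |Z ω - D|
    rw [abs_sub_comm]
    exact le_trans (by linarith) (le_abs_self _)
  · rw [div_le_iff₀ (by nlinarith)]
    nlinarith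

end Threshold

lemma flattenSampleCount_bounds {s : ℕ} (hs : 1 ≤ s) {ε : ℝ} (hε : 0 < ε) (hε1 : ε < 1) {m ρ τ : ℝ}
    (hm : m = flattenSampleCount 2400 s ε) (hρ : ρ = max (m / s) 1)
    (hτ : τ = m ^ 2 * ε ^ 2 / (10 * ρ)) : 240 ≤ τ ∧ 80 * (m / ρ) ≤ τ ^ 2 := by
  have hs0 : (0 : ℝ) < s := by exact_mod_cast hs
  have hs1 : (1 : ℝ) ≤ s := by exact_mod_cast hs
  have hceil : 2400 * max (ε ^ (-(4 : ℝ) / 3)) (ε ^ (-(2 : ℝ)) / Real.sqrt s) ≤ m := by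
    rw [hm]
    exact Nat.le_ceil _
  have hm1 : 2400 * ε ^ (-(4 : ℝ) / 3) ≤ m := le_trans (by gcongr; exact le_max_left _ _) hceil
  have hm2 : 2400 * (ε ^ (-(2 : ℝ)) / Real.sqrt s) ≤ m :=
    le_trans (by gcongr; exact le_max_right _ _) hceil
  have hone : 1 ≤ ε ^ (-(4 : ℝ) / 3) :=
    Real.one_le_rpow_of_pos_of_le_one_of_nonpos hε hε1.le (by norm_num)
  have hmpos : 2400 ≤ m := by linarith
  have hρ1 : 1 ≤ ρ := hρ ▸ le_max_right _ _
  set κ := m / ρ with hκ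
  have hκmain : 1 ≤ κ ∧ 2400 ^ 2 ≤ m ^ 2 * κ * ε ^ 4 := by
    rcases le_total (m / s) 1 with h | h
    · have hκm : κ = m := by rw [hκ, hρ, max_eq_right h, div_one]
      rw [hκm]
      refine ⟨by linarith, ?_⟩
      have h3 : (2400 * ε ^ (-(4 : ℝ) / 3)) ^ 3 ≤ m ^ 3 := by gcongr
      have h4 : (ε ^ (-(4 : ℝ) / 3)) ^ 3 * ε ^ 4 = 1 := by
        rw [← Real.rpow_natCast (ε ^ _), ← Real.rpow_mul hε.le, ← Real.rpow_natCast ε,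
          ← Real.rpow_add hε]
        norm_num
      have h5 := mul_le_mul_of_nonneg_right h3 (by positivity : 0 ≤ ε ^ 4)
      rw [mul_pow, mul_assoc, h4] at h5
      calc (2400 : ℝ) ^ 2 ≤ 2400 ^ 3 * 1 := by norm_num
        _ ≤ _ := h5
        _ = _ := by ring
    · have hκs : κ = s := by
        rw [hκ, hρ, max_eq_left h]
        field_simp
      rw [hκs]
      refine ⟨hs1, ?_⟩
      have h3 : (2400 * (ε ^ (-(2 : ℝ)) / Real.sqrt s)) ^ 2 ≤ m ^ 2 := by gcongr
      have h4 : (ε ^ (-(2 : ℝ)) / Real.sqrt s) ^ 2 * (s * ε ^ 4) = 1 := by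
        rw [div_pow, Real.sq_sqrt hs0.le, Real.rpow_neg hε.le, Real.rpow_two]
        field_simp
      have h5 := mul_le_mul_of_nonneg_right h3 (by positivity : 0 ≤ (s : ℝ) * ε ^ 4)
      rw [mul_pow, mul_assoc, h4] at h5
      linarith
  obtain ⟨hκ1, hκ2⟩ := hκmain
  have hτκ : τ = m * κ * ε ^ 2 / 10 := by
    rw [hτ, hκ]
    field_simp
  have hsq : 57600 * κ ≤ τ ^ 2 := by
    rw [hτκ]
    nlinarith [mul_le_mul_of_nonneg_right hκ2 (by linarith : 0 ≤ κ)]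
  have hτ0 : 0 ≤ τ := by
    rw [hτκ]
    positivity
  constructor
  · nlinarith
  · nlinarith

/-- **Lemma 2.8 (`Flatten-Closeness`).** There is a universal constant `C` such that for
all `n`, `s ∈ [n]`, `ε ∈ (0,1)` and `m = ⌈C·max(ε^(−4/3), ε^(−2)/√s)⌉`, there is a
(randomized, measurable) tester drawing `Poisson(m)` i.i.d. samples from each of `p, q`
(discrete distributions on `[n]`) that, with probability at least `9/10`, accepts if
`p = q` and rejects if there is a set `H` of `s` elements with
`Σ_{i∈H} (p_i − q_i)² ≥ ε²` and `max_{i∈H} (p_i + q_i)/2 ≤ 1/s`. -/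
theorem flatten_closeness_tester :
    ∃ C : ℝ, 1 ≤ C ∧
      ∀ n s : ℕ, 1 ≤ s → s ≤ n → ∀ ε : ℝ, 0 < ε → ε < 1 →
        ∃ T : (Σ a : ℕ, Fin a → Fin n) × (Σ b : ℕ, Fin b → Fin n) → ℝ,
          Measurable T ∧ (∀ x, T x ∈ Set.Icc (0 : ℝ) 1) ∧
          ∀ p q : Measure (Fin n), IsProbabilityMeasure p → IsProbabilityMeasure q →
            (p = q →
              (9 : ℝ) / 10 ≤ ∫ x, T x ∂((iidPoissonSamples (flattenSampleCount C s ε) p).prod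
                  (iidPoissonSamples (flattenSampleCount C s ε) q))) ∧
            ((∃ H : Finset (Fin n), H.card = s ∧
                ε ^ 2 ≤ ∑ i ∈ H, ((p {i}).toReal - (q {i}).toReal) ^ 2 ∧
                ∀ i ∈ H, ((p {i}).toReal + (q {i}).toReal) / 2 ≤ 1 / s) →
              (9 : ℝ) / 10 ≤ ∫ x, (1 - T x) ∂((iidPoissonSamples (flattenSampleCount C s ε) p).prod
                  (iidPoissonSamples (flattenSampleCount C s ε) q))) := by
  refine ⟨2400, by norm_num, fun n s hs _ ε hε hε1 => ?_⟩
  obtain ⟨hτ240, hκ⟩ := flattenSampleCount_bounds hs hε hε1 rfl rfl rfl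
  generalize flattenSampleCount 2400 s ε = m at hτ240 hκ ⊢
  obtain ⟨ρ, hρ⟩ : ∃ ρ : ℝ, ρ = max ((m : ℝ) / s) 1 := ⟨_, rfl⟩
  obtain ⟨τ, hτ⟩ : ∃ τ : ℝ, τ = (m : ℝ) ^ 2 * ε ^ 2 / (10 * ρ) := ⟨_, rfl⟩
  rw [← hρ, ← hτ] at hτ240 hκ
  have hρ1 : 1 ≤ ρ := hρ ▸ le_max_right _ _
  have hA : MeasurableSet {x | closenessStatistic (n := n) ρ x < τ} :=
    measurableSet_lt (measurable_closenessStatistic ρ) measurable_const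
  refine ⟨Set.indicator {x | closenessStatistic ρ x < τ} 1, measurable_one.indicator hA,
    fun x => ?_, fun p q _ _ => ?_⟩
  · by_cases hx : closenessStatistic ρ x < τ <;> simp [Set.indicator, hx]
  set μ := (iidPoissonSamples (m : ℝ≥0) p).prod (iidPoissonSamples (m : ℝ≥0) q) with hμ
  have hT : ∫ x, Set.indicator {x | closenessStatistic ρ x < τ} 1 x ∂μ =
      μ.real {x | closenessStatistic ρ x < τ} := integral_indicator_one hA
  have hZ := memLp_closenessStatistic (m : ℝ≥0) p q hρ1
  have hmean := integral_closenessStatistic (m : ℝ≥0) p q hρ1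
  have hvar := variance_closenessStatistic_le (m : ℝ≥0) p q hρ1
  rw [NNReal.coe_natCast] at hvar
  constructor
  · intro hpq
    have hzero : ∑ i, closenessMean ρ m p q i = 0 := by simp [closenessMean, hpq]
    rw [hzero] at hmean hvar
    have h1 := measureReal_threshold_le_of_centred hZ (by linarith) hκ hmean (by linarith)
    have h2 : {x | closenessStatistic (n := n) ρ x < τ}ᶜ = {x | τ ≤ closenessStatistic ρ x} := by
      ext x
      simp
    rw [hT]
    rw [← h2, probReal_compl_eq_one_sub hA] at h1
    linarith
  · rintro ⟨H, -, hHε, hH⟩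
    have hlow := le_sum_closenessMean (m : ℝ≥0) p q hρ1 (s := s)
      (by rw [NNReal.coe_natCast]; exact hρ ▸ le_max_left _ _) hHε hH
    rw [NNReal.coe_natCast] at hlow
    have h2τ : 2 * τ = (m : ℝ) ^ 2 * ε ^ 2 / (5 * ρ) := by
      rw [hτ]
      field_simp
      ring
    have h1 := measureReal_lt_threshold_le hZ hτ240 hκ (by rw [hmean, h2τ]; exact hlow)
      (by rw [hmean]; exact hvar)
    have hint : Integrable (fun x =>
        Set.indicator {x | closenessStatistic ρ x < τ} (1 : _ × _ → ℝ) x) μ :=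
      (integrable_const (1 : ℝ)).indicator hA
    rw [integral_sub (integrable_const _) hint, hT]
    simp only [integral_const, probReal_univ, smul_eq_mul, mul_one]
    linarith
end

section
/- Let t, r be the square-edge distributions. Then for m = 1, 2, 3, the order-sampling distributions satisfy D((t+r)/2, (t+r)/2, m) = (1/2)·( D(t, r, m) + D(r, t, m) ) as distributions on S_m × S_m × {0,1}^m. -/
open MeasureTheory
open scoped ENNReal

/-- The square-edge distribution `t` (uniform on the upper-left and lower-right edges of
the square with vertices `(1/2,0)`, `(1,1/2)`, `(1/2,1)`, `(0,1/2)`). -/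
noncomputable def tDist : Measure (ℝ × ℝ) :=
  (volume.restrict (Set.Icc (0 : ℝ) 1)).map fun s =>
    if s ≤ 1 / 2 then (s, 1 / 2 + s) else (s, s - 1 / 2)

/-- The square-edge distribution `r` (uniform on the lower-left and upper-right edges). -/
noncomputable def rDist : Measure (ℝ × ℝ) :=
  (volume.restrict (Set.Icc (0 : ℝ) 1)).map fun s =>
    if s ≤ 1 / 2 then (s, 1 / 2 - s) else (s, 3 / 2 - s)

/-- Labeled sampling from a pair of distributions `(p, q)` on `ℝ²`: independently for
each `i`, draw a uniform label `ℓ i ∈ {0,1}` and then a point from `p` if `ℓ i = false`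
and from `q` if `ℓ i = true`.  The result is the joint law of the points and labels. -/
noncomputable def labeledSamples (m : ℕ) (p q : Measure (ℝ × ℝ)) :
    Measure ((Fin m → ℝ × ℝ) × (Fin m → Bool)) :=
  ((PMF.uniformOfFintype (Fin m → Bool)).toMeasure).bind fun ℓ =>
    (Measure.pi fun i => if ℓ i then q else p).map fun xs => (xs, ℓ)

/-- The order tuple of a labeled sample: the ranks of the `x`-coordinates, the ranks of
the `y`-coordinates (ties broken by index, which is distributionally equivalent to
uniform tie-breaking for exchangeable samples), and the labels. -/
noncomputable def orderTuple (m : ℕ) (s : (Fin m → ℝ × ℝ) × (Fin m → Bool)) :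
    (Fin m → ℕ) × (Fin m → ℕ) × (Fin m → Bool) :=
  (fun i => (Finset.univ.filter fun j =>
      (s.1 j).1 < (s.1 i).1 ∨ ((s.1 j).1 = (s.1 i).1 ∧ j < i)).card,
   fun i => (Finset.univ.filter fun j =>
      (s.1 j).2 < (s.1 i).2 ∨ ((s.1 j).2 = (s.1 i).2 ∧ j < i)).card,
   s.2)

/-- `D(p, q, m)`: the distribution of the order tuple of `m` labeled samples from the
pair `(p, q)`. -/
noncomputable def orderDist (m : ℕ) (p q : Measure (ℝ × ℝ)) :
    Measure ((Fin m → ℕ) × (Fin m → ℕ) × (Fin m → Bool)) :=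
  (labeledSamples m p q).map (orderTuple m)

/-- The sign in `{1, -1}` encoded by a Boolean. -/
def boolSign (b : Bool) : ℝ := if b then 1 else -1

/-- The rank vector of a tuple of reals, with ties broken by index. -/
noncomputable def rankVec {m : ℕ} (v : Fin m → ℝ) : Fin m → ℕ := fun i =>
  (Finset.univ.filter fun j => v j < v i ∨ (v j = v i ∧ j < i)).card

/-- The point of the square at horizontal distance `a` and vertical distance `1 / 2 - a` from the
center, in the quadrant prescribed by the Booleans `b` and `d`. -/
noncomputable def squarePoint (b d : Bool) (a : ℝ) : ℝ × ℝ :=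
  (1 / 2 + boolSign b * a, 1 / 2 + boolSign d * (1 / 2 - a))

/-- Lebesgue measure on the horizontal distances to the center of the square. -/
noncomputable def offsetMeasure : Measure ℝ := volume.restrict (Set.Ioo 0 (1 / 2))

instance : IsFiniteMeasure offsetMeasure := by
  unfold offsetMeasure; infer_instance

/-- The two square-edge distributions, indexed by a Boolean. -/
noncomputable def edgePair (c : Bool) : Measure (ℝ × ℝ) := if c then tDist else rDist

lemma measurable_squarePoint (b d : Bool) : Measurable (squarePoint b d) := by
  unfold squarePoint; fun_prop

lemma measurable_rankVec {m : ℕ} : Measurable (rankVec : (Fin m → ℝ) → Fin m → ℕ) := by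
  refine measurable_pi_lambda _ fun i => ?_
  simp only [rankVec, Finset.card_filter]
  refine Finset.measurable_fun_sum _ fun j _ => Measurable.ite ?_ measurable_const measurable_const
  refine MeasurableSet.union (measurableSet_lt (measurable_pi_apply j) (measurable_pi_apply i)) ?_
  exact MeasurableSet.inter (measurableSet_eq_fun (measurable_pi_apply j) (measurable_pi_apply i))
    (MeasurableSet.const _)

/-- The sign of the smallest of a family of distinct positive numbers does not influence the
ranks of the signed family. -/
lemma rankVec_signed_congr {m : ℕ} {v : Fin m → ℝ} (hpos : ∀ i, 0 < v i)
    (hinj : Function.Injective v) {k : Fin m} (hk : ∀ i, v k ≤ v i) {s s' : Fin m → Bool}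
    (h : ∀ i, i ≠ k → s i = s' i) :
    rankVec (fun i => 1 / 2 + boolSign (s i) * v i) =
      rankVec (fun i => 1 / 2 + boolSign (s' i) * v i) := by
  funext i
  unfold rankVec
  congr 1
  refine Finset.filter_congr fun j _ => ?_
  beta_reduce
  by_cases hij : j = i
  · simp [hij]
  have hi := hpos i
  have hj := hpos j
  have hne : v j ≠ v i := fun e => hij (hinj e)
  have hlt := lt_or_gt_of_ne hne
  by_cases hik : i = k
  · subst hik
    rw [h j hij]
    have := hk j
    cases s i <;> cases s' i <;> cases s' j <;> simp only [boolSign] <;> grind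
  · rw [h i hik]
    by_cases hjk : j = k
    · subst hjk
      have := hk i
      cases s j <;> cases s' j <;> cases s' i <;> simp only [boolSign] <;> grind
    · rw [h j hjk]

/-- If `X` ignores coordinate `k₁`, `Y` ignores coordinate `k₂` and there is at most one further
coordinate, then the sum of `f (X ε) (Y δ)` over the sign vectors whose product is `c` or its
negation does not depend on `c`. -/
lemma sum_xor_add_sum_xor_not_eq {ι α β M : Type*} [Fintype ι] [DecidableEq ι] [AddCommMonoid M]
    (f : α → β → M) (X : (ι → Bool) → α) (Y : (ι → Bool) → β) {k₁ k₂ k₃ : ι}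
    (hk : ∀ i, i = k₁ ∨ i = k₂ ∨ i = k₃)
    (hX : ∀ s s', (∀ i, i ≠ k₁ → s i = s' i) → X s = X s')
    (hY : ∀ s s', (∀ i, i ≠ k₂ → s i = s' i) → Y s = Y s') (c c' : ι → Bool) :
    ∑ s : ι → Bool, f (X s) (Y fun i => xor (s i) (c i)) +
        ∑ s : ι → Bool, f (X s) (Y fun i => xor (s i) (!c i)) =
      ∑ s : ι → Bool, f (X s) (Y fun i => xor (s i) (c' i)) +
        ∑ s : ι → Bool, f (X s) (Y fun i => xor (s i) (!c' i)) := by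
  set S : (ι → Bool) → M := fun c => ∑ s : ι → Bool, f (X s) (Y fun i => xor (s i) (c i))
  have hS₂ : ∀ c c' : ι → Bool, (∀ i, i ≠ k₂ → c i = c' i) → S c = S c' := by
    intro c c' h
    refine Finset.sum_congr rfl fun s _ => ?_
    rw [hY (fun i => xor (s i) (c i)) (fun i => xor (s i) (c' i)) fun i hi => by simp only [h i hi]]
  have hswap : ∀ c : ι → Bool, S c = ∑ s : ι → Bool, f (X fun i => xor (s i) (c i)) (Y s) := by
    intro c
    have hinv : Function.Involutive fun (s : ι → Bool) i => xor (s i) (c i) := by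
      intro s; funext i; simp
    refine Fintype.sum_equiv hinv.toPerm _ _ fun s => ?_
    simp
  have hS₁ : ∀ c c' : ι → Bool, (∀ i, i ≠ k₁ → c i = c' i) → S c = S c' := by
    intro c c' h
    rw [hswap, hswap]
    refine Finset.sum_congr rfl fun s _ => ?_
    rw [hX (fun i => xor (s i) (c i)) (fun i => xor (s i) (c' i)) fun i hi => by simp only [h i hi]]
  have hS₃ : ∀ c c' : ι → Bool, c k₃ = c' k₃ → S c = S c' := by
    intro c c' h
    refine (hS₁ c (Function.update c k₁ (c' k₁)) fun i hi => by simp [hi]).trans (hS₂ _ _ ?_)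
    intro i hi
    rcases eq_or_ne i k₁ with rfl | hi₁
    · simp
    · obtain rfl : i = k₃ := ((hk i).resolve_left hi₁).resolve_left hi
      simp [hi₁, h]
  change S c + S (fun i => !c i) = S c' + S (fun i => !c' i)
  by_cases h : c k₃ = c' k₃
  · rw [hS₃ c c' h, hS₃ (fun i => !c i) (fun i => !c' i) (by simp [h])]
  · have h' : c k₃ = !c' k₃ := Bool.eq_not.2 h
    rw [hS₃ c (fun i => !c' i) h', hS₃ (fun i => !c i) c' (by simp [h']), add_comm]

lemma exists_forall_eq_or_eq_or_eq {m : ℕ} (h3 : m ≤ 3) {k₁ k₂ : Fin m} (h : k₁ ≠ k₂) :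
    ∃ k₃, ∀ i, i = k₁ ∨ i = k₂ ∨ i = k₃ := by
  interval_cases m <;> revert k₁ k₂ <;> decide

lemma pi_sum_eq_sum_pi {ι κ Ω : Type*} [Fintype ι] [DecidableEq ι] [Fintype κ] [MeasurableSpace Ω]
    (ν : ι → κ → Measure Ω) [∀ i b, IsFiniteMeasure (ν i b)] :
    Measure.pi (fun i => ∑ b, ν i b) = ∑ s : ι → κ, Measure.pi fun i => ν i (s i) := by
  refine (Measure.pi_eq fun A hA => ?_)
  simp only [Measure.finsetSum_apply, Measure.pi_pi]
  rw [Finset.prod_univ_sum, Fintype.piFinset_univ]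

lemma restrict_Icc_eq_sum_map_offsetMeasure :
    volume.restrict (Set.Icc (0 : ℝ) 1) =
      ∑ b, offsetMeasure.map fun a => 1 / 2 + boolSign b * a := by
  have hr : volume.restrict (Set.Ioo (1 / 2 : ℝ) 1) = offsetMeasure.map fun a => 1 / 2 + a := by
    have := ((measurePreserving_add_left volume (1 / 2 : ℝ)).restrict_preimage
      (measurableSet_Ioo (a := (1 / 2 : ℝ)) (b := 1))).map_eq
    rw [← this, offsetMeasure]
    congr 2
    ext x; simp only [Set.mem_preimage, Set.mem_Ioo]; grind
  have hl : volume.restrict (Set.Ioo (0 : ℝ) (1 / 2)) = offsetMeasure.map fun a => 1 / 2 - a := by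
    have := ((Measure.measurePreserving_sub_left volume (1 / 2 : ℝ)).restrict_preimage
      (measurableSet_Ioo (a := (0 : ℝ)) (b := 1 / 2))).map_eq
    rw [← this, offsetMeasure]
    congr 2
    ext x; simp only [Set.mem_preimage, Set.mem_Ioo]; grind
  have hu : Set.Icc (0 : ℝ) (1 / 2) ∪ Set.Ioc (1 / 2) 1 = Set.Icc 0 1 :=
    Set.Icc_union_Ioc_eq_Icc (by norm_num) (by norm_num)
  rw [← hu, Measure.restrict_union (by
    rw [Set.disjoint_left]; intro x hx hx'; exact absurd hx.2 (not_le.2 hx'.1)) measurableSet_Ioc,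
    ← Measure.restrict_congr_set (Ioo_ae_eq_Icc (μ := volume)),
    ← Measure.restrict_congr_set (Ioo_ae_eq_Ioc (μ := volume)), hr, hl]
  simp [boolSign, sub_eq_add_neg, add_comm]

lemma edgePair_eq_sum (c : Bool) :
    edgePair c = ∑ b, offsetMeasure.map (squarePoint b (xor b c)) := by
  have key : ∀ g : ℝ → ℝ × ℝ, Measurable g →
      (∀ b, ∀ a ∈ Set.Ioo (0 : ℝ) (1 / 2),
        g (1 / 2 + boolSign b * a) = squarePoint b (xor b c) a) →
      (volume.restrict (Set.Icc (0 : ℝ) 1)).map g =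
        ∑ b, offsetMeasure.map (squarePoint b (xor b c)) := by
    intro g hg h
    rw [restrict_Icc_eq_sum_map_offsetMeasure, Fintype.sum_bool, Measure.map_add _ _ hg,
      Measure.map_map hg (by fun_prop), Measure.map_map hg (by fun_prop), Fintype.sum_bool]
    congr 1 <;>
    · refine Measure.map_congr ?_
      filter_upwards [ae_restrict_mem measurableSet_Ioo] with a ha
      exact h _ a ha
  cases c
  · refine key _ (Measurable.ite measurableSet_Iic (by fun_prop) (by fun_prop)) ?_
    rintro (_ | _) a ⟨h₀, h₁⟩ <;> simp only [squarePoint, boolSign] <;> grind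
  · refine key _ (Measurable.ite measurableSet_Iic (by fun_prop) (by fun_prop)) ?_
    rintro (_ | _) a ⟨h₀, h₁⟩ <;> simp only [squarePoint, boolSign] <;> grind

instance (c : Bool) : IsFiniteMeasure (edgePair c) := by
  rw [edgePair_eq_sum]; infer_instance

lemma pi_edgePair_eq_sum {m : ℕ} (c : Fin m → Bool) :
    Measure.pi (fun i => edgePair (c i)) = ∑ s : Fin m → Bool,
      (Measure.pi fun _ : Fin m => offsetMeasure).map
        fun a i => squarePoint (s i) (xor (s i) (c i)) (a i) := by
  simp only [edgePair_eq_sum]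
  rw [pi_sum_eq_sum_pi fun i b => offsetMeasure.map (squarePoint b (xor b (c i)))]
  refine Finset.sum_congr rfl fun s _ => ?_
  exact (Measure.pi_map_pi fun i => (measurable_squarePoint _ _).aemeasurable).symm

lemma ae_pi_offsetMeasure (m : ℕ) :
    ∀ᵐ a ∂(Measure.pi fun _ : Fin m => offsetMeasure),
      (∀ i, a i ∈ Set.Ioo (0 : ℝ) (1 / 2)) ∧ Function.Injective a := by
  have hinj : ∀ᵐ a : Fin m → ℝ, Function.Injective a := by
    have : ∀ i j : Fin m, i ≠ j → ∀ᵐ a : Fin m → ℝ, a i ≠ a j := by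
      intro i j hij
      let V : Submodule ℝ (Fin m → ℝ) :=
        LinearMap.ker (LinearMap.proj (R := ℝ) (φ := fun _ : Fin m => ℝ) i - LinearMap.proj j)
      have hV : V ≠ ⊤ := by
        intro h
        have : (Pi.single i 1 : Fin m → ℝ) ∈ V := h ▸ Submodule.mem_top
        simp [V, hij.symm] at this
      refine measure_mono_null (fun a ha => ?_) (Measure.addHaar_submodule volume V hV)
      simpa [V, sub_eq_zero] using ha
    have h := ae_all_iff.2 fun i => ae_all_iff.2 fun j => ae_all_iff.2 (this i j)
    filter_upwards [h] with a ha i j hij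
    by_contra hne
    exact ha i j hne hij
  unfold offsetMeasure
  rw [← Measure.restrict_pi_pi]
  filter_upwards [ae_restrict_of_ae hinj,
    ae_restrict_mem (MeasurableSet.univ_pi fun _ => measurableSet_Ioo)] with a h₁ h₂
  exact ⟨fun i => h₂ i trivial, h₁⟩

lemma measurable_rankVec_pair {m : ℕ} :
    Measurable fun xs : Fin m → ℝ × ℝ =>
      (rankVec fun i => (xs i).1, rankVec fun i => (xs i).2) :=
  (measurable_rankVec.comp (by fun_prop)).prodMk (measurable_rankVec.comp (by fun_prop))

/-- The probability of an order event under a product of edge distributions, symmetrized by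
exchanging the two distributions, does not depend on the chosen distributions. -/
lemma pi_edgePair_add_pi_edgePair_not_eq {m : ℕ} (h1 : 1 ≤ m) (h3 : m ≤ 3)
    (A : Set ((Fin m → ℕ) × (Fin m → ℕ))) (c c' : Fin m → Bool) :
    (Measure.pi fun i => edgePair (c i))
        {xs | (rankVec fun i => (xs i).1, rankVec fun i => (xs i).2) ∈ A} +
      (Measure.pi fun i => edgePair (!c i))
        {xs | (rankVec fun i => (xs i).1, rankVec fun i => (xs i).2) ∈ A} =
    (Measure.pi fun i => edgePair (c' i))
        {xs | (rankVec fun i => (xs i).1, rankVec fun i => (xs i).2) ∈ A} +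
      (Measure.pi fun i => edgePair (!c' i))
        {xs | (rankVec fun i => (xs i).1, rankVec fun i => (xs i).2) ∈ A} := by
  let f : (Fin m → ℕ) → (Fin m → ℕ) → ℝ≥0∞ := fun u v => A.indicator 1 (u, v)
  let F : (Fin m → Bool) → (Fin m → Bool) → (Fin m → ℝ) → ℝ≥0∞ := fun s c a =>
    f (rankVec fun i => 1 / 2 + boolSign (s i) * a i)
      (rankVec fun i => 1 / 2 + boolSign (xor (s i) (c i)) * (1 / 2 - a i))
  have hF : ∀ s c, Measurable (F s c) := fun s c => by
    have hx : Measurable fun (a : Fin m → ℝ) i => 1 / 2 + boolSign (s i) * a i := by fun_prop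
    have hy : Measurable fun (a : Fin m → ℝ) i =>
        1 / 2 + boolSign (xor (s i) (c i)) * (1 / 2 - a i) := by fun_prop
    have hf : Measurable (A.indicator (fun _ => 1) : (Fin m → ℕ) × (Fin m → ℕ) → ℝ≥0∞) :=
      Measurable.of_discrete
    exact hf.comp ((measurable_rankVec.comp hx).prodMk (measurable_rankVec.comp hy))
  have hE : ∀ c : Fin m → Bool, (Measure.pi fun i => edgePair (c i))
        {xs | (rankVec fun i => (xs i).1, rankVec fun i => (xs i).2) ∈ A} =
      ∫⁻ a, ∑ s, F s c a ∂(Measure.pi fun _ : Fin m => offsetMeasure) := by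
    intro c
    have hB : MeasurableSet
        {xs : Fin m → ℝ × ℝ | (rankVec fun i => (xs i).1, rankVec fun i => (xs i).2) ∈ A} :=
      measurable_rankVec_pair (MeasurableSet.of_discrete (s := A))
    rw [pi_edgePair_eq_sum, Measure.finsetSum_apply, lintegral_finsetSum _ fun s _ => hF s c]
    refine Finset.sum_congr rfl fun s _ => ?_
    have hg : Measurable fun (a : Fin m → ℝ) i => squarePoint (s i) (xor (s i) (c i)) (a i) :=
      measurable_pi_lambda _ fun i => (measurable_squarePoint _ _).comp (measurable_pi_apply i)
    rw [Measure.map_apply hg hB, ← lintegral_indicator_one (hg hB)]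
    rfl
  rw [hE, hE, hE, hE,
    ← lintegral_add_left (Finset.measurable_fun_sum _ fun s _ => hF s c),
    ← lintegral_add_left (Finset.measurable_fun_sum _ fun s _ => hF s c')]
  refine lintegral_congr_ae ?_
  filter_upwards [ae_pi_offsetMeasure m] with a ⟨ha, hinj⟩
  have : Nonempty (Fin m) := ⟨⟨0, h1⟩⟩
  obtain ⟨k₁, hk₁⟩ := Finite.exists_min a
  obtain ⟨k₂, hk₂⟩ := Finite.exists_max a
  obtain ⟨k₃, hk⟩ : ∃ k₃, ∀ i, i = k₁ ∨ i = k₂ ∨ i = k₃ := by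
    rcases eq_or_ne k₁ k₂ with rfl | hne
    · exact ⟨k₁, fun i => Or.inl (hinj (le_antisymm (hk₂ i) (hk₁ i)))⟩
    · exact exists_forall_eq_or_eq_or_eq h3 hne
  exact sum_xor_add_sum_xor_not_eq f (fun s => rankVec fun i => 1 / 2 + boolSign (s i) * a i)
    (fun s => rankVec fun i => 1 / 2 + boolSign (s i) * (1 / 2 - a i)) hk
    (fun s s' h => rankVec_signed_congr (fun i => (ha i).1) hinj hk₁ h)
    (fun s s' h => rankVec_signed_congr (v := fun i => 1 / 2 - a i)
      (fun i => sub_pos.2 (ha i).2) (fun i j hij => hinj (sub_right_injective hij))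
      (fun i => sub_le_sub_left (hk₂ i) _) h) c c'

lemma measurable_orderTuple (m : ℕ) : Measurable (orderTuple m) :=
  (measurable_rankVec.comp (by fun_prop)).prodMk
    ((measurable_rankVec.comp (by fun_prop)).prodMk measurable_snd)

lemma orderDist_apply (m : ℕ) (p q : Measure (ℝ × ℝ))
    (A : Set ((Fin m → ℕ) × (Fin m → ℕ) × (Fin m → Bool))) :
    orderDist m p q A = ∑ ℓ : Fin m → Bool,
      (Measure.pi fun i => if ℓ i then q else p)
        {xs | (rankVec fun i => (xs i).1, rankVec fun i => (xs i).2) ∈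
          {u : (Fin m → ℕ) × (Fin m → ℕ) | (u.1, u.2, ℓ) ∈ A}} *
      (PMF.uniformOfFintype (Fin m → Bool)).toMeasure {ℓ} := by
  have hA := measurable_orderTuple m (MeasurableSet.of_discrete (s := A))
  rw [orderDist, Measure.map_apply (measurable_orderTuple m) MeasurableSet.of_discrete,
    labeledSamples, Measure.bind_apply hA Measurable.of_discrete.aemeasurable, lintegral_fintype]
  refine Finset.sum_congr rfl fun ℓ _ => ?_
  rw [Measure.map_apply measurable_prodMk_right hA]
  rfl

lemma pi_half_smul_add_apply {m : ℕ} (B : Set (Fin m → ℝ × ℝ)) :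
    (Measure.pi fun _ : Fin m => (2 : ℝ≥0∞)⁻¹ • (tDist + rDist)) B =
      (2 : ℝ≥0∞)⁻¹ ^ m * ∑ c : Fin m → Bool, (Measure.pi fun i => edgePair (c i)) B := by
  have h : tDist + rDist = ∑ b, edgePair b := by simp [edgePair]
  have hpi : (Measure.pi fun _ : Fin m => (2 : ℝ≥0∞)⁻¹ • (tDist + rDist)) =
      (2 : ℝ≥0∞)⁻¹ ^ m • ∑ c : Fin m → Bool, Measure.pi fun i => edgePair (c i) := by
    rw [← pi_sum_eq_sum_pi fun (_ : Fin m) b => edgePair b, h]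
    have : IsFiniteMeasure ((2 : ℝ≥0∞)⁻¹ • ∑ b, edgePair b) :=
      Measure.smul_finite _ (by simp)
    refine Measure.pi_eq fun A hA => ?_
    simp [Measure.pi_pi, ← mul_add, Finset.prod_mul_distrib]
  rw [hpi, Measure.smul_apply, Measure.finsetSum_apply, smul_eq_mul]

/-- **Lemma 3.3.** For `m = 1, 2, 3`, the order-sampling distribution of the pair
`((t+r)/2, (t+r)/2)` coincides with the uniform mixture of the order-sampling
distributions of the pairs `(t, r)` and `(r, t)`. -/
theorem square_edge_order_indistinguishable (m : ℕ) (h1 : 1 ≤ m) (h3 : m ≤ 3) :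
    orderDist m ((2 : ℝ≥0∞)⁻¹ • (tDist + rDist)) ((2 : ℝ≥0∞)⁻¹ • (tDist + rDist)) =
      (2 : ℝ≥0∞)⁻¹ • (orderDist m tDist rDist + orderDist m rDist tDist) := by
  ext A -
  simp only [Measure.smul_apply, Measure.add_apply, orderDist_apply, smul_eq_mul, ite_self]
  rw [← Finset.sum_add_distrib, Finset.mul_sum]
  refine Finset.sum_congr rfl fun ℓ _ => ?_
  rw [← add_mul, ← mul_assoc]
  congr 1
  rw [pi_half_smul_add_apply]
  set B : Set (Fin m → ℝ × ℝ) := {xs | (rankVec fun i => (xs i).1, rankVec fun i => (xs i).2) ∈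
    {u : (Fin m → ℕ) × (Fin m → ℕ) | (u.1, u.2, ℓ) ∈ A}}
  have hr : (fun i => if ℓ i then tDist else rDist) = fun i => edgePair (ℓ i) := rfl
  have ht : (fun i => if ℓ i then rDist else tDist) = fun i => edgePair (!ℓ i) := by
    funext i; cases ℓ i <;> simp [edgePair]
  rw [hr, ht, add_comm]
  set G := (Measure.pi fun i => edgePair (ℓ i)) B + (Measure.pi fun i => edgePair (!ℓ i)) B
  have hnot : Function.Involutive fun (c : Fin m → Bool) i => !c i := fun c => by simp
  have hsum : ∑ c : Fin m → Bool, (Measure.pi fun i => edgePair (c i)) B +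
      ∑ c : Fin m → Bool, (Measure.pi fun i => edgePair (c i)) B = 2 ^ m * G := by
    nth_rewrite 2 [← Equiv.sum_comp hnot.toPerm]
    rw [← Finset.sum_add_distrib]
    refine (Finset.sum_congr rfl fun c _ =>
      pi_edgePair_add_pi_edgePair_not_eq h1 h3 {u | (u.1, u.2, ℓ) ∈ A} c ℓ).trans ?_
    simp [G, B, mul_add]
  have hhalf : ∑ c : Fin m → Bool, (Measure.pi fun i => edgePair (c i)) B =
      2⁻¹ * (2 ^ m * G) := by
    rw [← hsum, ← two_mul, ← mul_assoc, ENNReal.inv_mul_cancel (by simp) (by simp), one_mul]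
  rw [hhalf, mul_left_comm, ← mul_assoc (_ ^ m), ← mul_pow,
    ENNReal.inv_mul_cancel (by simp) (by simp), one_pow, one_mul]
end
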